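/- Every periodic braid is conjugate to a power of δ or to a power of ε. Precisely: let α ∈ B_n and suppose there exist integers m ≠ 0 and p with α^m = Δ^p. Then there exists an integer k such that α is conjugate in B_n to δ^k or α is conjugate in B_n to ε^k. -/

import Mathlib

/-- The set of Artin braid relations in the free group on `n - 1` generators:
`σᵢσⱼ = σⱼσᵢ` for `|i - j| > 1` and `σᵢσⱼσᵢ = σⱼσᵢσⱼ` for `|i - j| = 1`. -/
def braidRels (n : ℕ) : Set (FreeGroup (Fin (n - 1))) :=
  { r | (∃ i j : Fin (n - 1), (i : ℕ) + 1 < (j : ℕ) ∧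
          r = FreeGroup.of i * FreeGroup.of j * (FreeGroup.of j * FreeGroup.of i)⁻¹) ∨
        (∃ i j : Fin (n - 1), (j : ℕ) = (i : ℕ) + 1 ∧
          r = FreeGroup.of i * FreeGroup.of j * FreeGroup.of i *
              (FreeGroup.of j * FreeGroup.of i * FreeGroup.of j)⁻¹) }

/-- The braid group on `n` strands, via the Artin presentation. -/
abbrev BraidGroup (n : ℕ) : Type := PresentedGroup (braidRels n)

/-- The standard Artin generator `σᵢ` (`0`-indexed: `i = 0, …, n - 2`). -/
def braidGen (n : ℕ) (i : Fin (n - 1)) : BraidGroup n := PresentedGroup.of i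

/-- The generator `σᵢ` indexed by a natural number (`1` if out of range). -/
def sigmaN (n : ℕ) (i : ℕ) : BraidGroup n :=
  if h : i < n - 1 then braidGen n ⟨i, h⟩ else 1

/-- The descending run `σₖ σₖ₋₁ ⋯ σ₀` (0-indexed). -/
def descRun (n k : ℕ) : BraidGroup n :=
  (((List.range (k + 1)).reverse).map (sigmaN n)).prod

/-- The half twist `Δ = σ₁(σ₂σ₁)(σ₃σ₂σ₁)⋯(σₙ₋₁σₙ₋₂⋯σ₁)` (written 1-indexed). -/
def halfTwist (n : ℕ) : BraidGroup n :=
  ((List.range (n - 1)).map (descRun n)).prod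

/-- The braid `δ = σ₁σ₂⋯σₙ₋₁` (written 1-indexed). -/
def deltaBraid (n : ℕ) : BraidGroup n :=
  ((List.range (n - 1)).map (sigmaN n)).prod

/-- The braid `ε = σ₁δ = σ₁(σ₁σ₂⋯σₙ₋₁)` (written 1-indexed). -/
def epsBraid (n : ℕ) : BraidGroup n := sigmaN n 0 * deltaBraid n

/-- A sequence of elements satisfying the braid relations in the range `[0, N)`. -/
structure BrSeq {G : Type*} [Group G] (N : ℕ) (s : ℕ → G) : Prop where
  comm : ∀ i j, i + 1 < j → j < N → s i * s j = s j * s i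
  braid : ∀ i, i + 1 < N → s i * s (i + 1) * s i = s (i + 1) * s i * s (i + 1)

namespace BrSeq

variable {G : Type*} [Group G]

/-- ascending product -/
def dd (s : ℕ → G) : ℕ → G
  | 0 => 1
  | k + 1 => dd s k * s k

/-- descending product -/
def db (s : ℕ → G) : ℕ → G
  | 0 => 1
  | k + 1 => s k * db s k

/-- half twist -/
def HT (s : ℕ → G) : ℕ → G
  | 0 => 1
  | k + 1 => HT s k * db s (k + 1)

variable {N : ℕ} {s : ℕ → G}

theorem mono (h : BrSeq N s) {M : ℕ} (hM : M ≤ N) : BrSeq M s :=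
  ⟨fun i j h1 h2 => h.comm i j h1 (by omega), fun i h1 => h.braid i (by omega)⟩

theorem map (h : BrSeq N s) {H : Type*} [Group H] (f : G →* H) : BrSeq N (fun i => f (s i)) :=
  ⟨fun i j h1 h2 => by rw [← map_mul, ← map_mul, h.comm i j h1 h2],
   fun i h1 => by simp only [← map_mul, h.braid i h1]⟩

theorem map_dd {H : Type*} [Group H] (f : G →* H) (s : ℕ → G) (k : ℕ) :
    f (dd s k) = dd (fun i => f (s i)) k := by
  induction k with
  | zero => simp [dd]
  | succ k ih => simp [dd, ih]

theorem dd_congr {s t : ℕ → G} (k : ℕ) (h : ∀ i < k, s i = t i) : dd s k = dd t k := by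
  induction k with
  | zero => rfl
  | succ k ih => simp only [dd]; rw [ih fun i hi => h i (by omega), h k (by omega)]

theorem dd_comm (h : BrSeq N s) {k j : ℕ} (hkj : k < j) (hj : j < N) :
    dd s k * s j = s j * dd s k := by
  induction k with
  | zero => simp [dd]
  | succ k ih =>
    simp only [dd]
    rw [mul_assoc, h.comm k j hkj hj, ← mul_assoc, ih (by omega), mul_assoc]

theorem db_comm (h : BrSeq N s) {k j : ℕ} (hkj : k < j) (hj : j < N) :
    db s k * s j = s j * db s k := by
  induction k with
  | zero => simp [db]
  | succ k ih =>
    simp only [db]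
    rw [mul_assoc, ih (by omega), ← mul_assoc, h.comm k j hkj hj, mul_assoc]

theorem HT_comm (h : BrSeq N s) {k j : ℕ} (hkj : k < j) (hj : j < N) :
    HT s k * s j = s j * HT s k := by
  induction k with
  | zero => simp [HT]
  | succ k ih =>
    simp only [HT]
    rw [mul_assoc, h.db_comm hkj hj, ← mul_assoc, ih (by omega), mul_assoc]

theorem dd_shift (h : BrSeq N s) {k i : ℕ} (hik : i + 1 < k) (hk : k ≤ N) :
    dd s k * s i = s (i + 1) * dd s k := by
  induction k with
  | zero => omega
  | succ k ih =>
    rcases Nat.lt_or_ge (i + 1) k with h1 | h1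
    · simp only [dd]
      rw [mul_assoc, ← h.comm i k h1 (by omega), ← mul_assoc, ih h1 (by omega), mul_assoc]
    · obtain rfl : k = i + 1 := by omega
      simp only [dd]
      rw [mul_assoc, mul_assoc, ← mul_assoc (s i), h.braid i (by omega), ← mul_assoc, ← mul_assoc,
        h.dd_comm (by omega) (by omega)]
      simp only [mul_assoc]

theorem db_shift (h : BrSeq N s) {k i : ℕ} (hik : i + 1 < k) (hk : k ≤ N) :
    db s k * s (i + 1) = s i * db s k := by
  induction k with
  | zero => omega
  | succ k ih =>
    rcases Nat.lt_or_ge (i + 1) k with h1 | h1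
    · simp only [db]
      rw [mul_assoc, ih h1 (by omega), ← mul_assoc, ← h.comm i k h1 (by omega), mul_assoc]
    · obtain rfl : k = i + 1 := by omega
      simp only [db]
      rw [mul_assoc, mul_assoc, h.db_comm (by omega) (by omega), ← mul_assoc, ← mul_assoc,
        ← h.braid i (by omega)]
      simp only [mul_assoc]

theorem eps_step (h : BrSeq N s) {k : ℕ} (hk : k + 1 ≤ N) :
    s 0 * (dd s N * dd s k) = dd s (k + 1) * dd s N := by
  induction k with
  | zero => simp [dd]
  | succ k ih =>
    rw [dd, ← mul_assoc (dd s N), ← mul_assoc, ih (by omega), mul_assoc,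
      h.dd_shift (by omega) le_rfl, ← mul_assoc, ← dd]

theorem eps_pow (h : BrSeq N s) {k : ℕ} (hk : k ≤ N) :
    (s 0 * dd s N) ^ k = dd s k * dd s N ^ k := by
  induction k with
  | zero => simp [dd]
  | succ k ih =>
    rw [pow_succ', ih (by omega), pow_succ', mul_assoc, ← mul_assoc (dd s N), ← mul_assoc,
      h.eps_step hk, mul_assoc]

theorem eps_pow_eq (h : BrSeq N s) : (s 0 * dd s N) ^ N = dd s N ^ (N + 1) := by
  rw [h.eps_pow le_rfl, pow_succ']

theorem z_comm (h : BrSeq N s) {i : ℕ} (hi : i < N) : Commute (dd s N ^ (N + 1)) (s i) := by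
  induction i with
  | zero =>
    have h1 : Commute (dd s N ^ (N + 1)) (s 0 * dd s N) := by
      rw [← h.eps_pow_eq]; exact Commute.pow_self _ _
    have h2 : Commute (dd s N ^ (N + 1)) (dd s N) := Commute.pow_self _ _
    have := h1.mul_right h2.inv_right
    simpa using this
  | succ i ih =>
    have h2 : Commute (dd s N ^ (N + 1)) (dd s N) := Commute.pow_self _ _
    have h3 : s (i + 1) = dd s N * s i * (dd s N)⁻¹ := by
      rw [h.dd_shift hi le_rfl]; simp
    rw [h3]
    exact (h2.mul_right (ih (by omega))).mul_right h2.inv_right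

theorem dd_pow_aux (h : BrSeq N s) {k i : ℕ} (hk : k + 1 ≤ N) (j : ℕ) (hj : i + j = k) :
    db s (k + 1) * (db s (i + 1))⁻¹ * dd s (k + 1) = dd s k * db s (k + 1) * (db s i)⁻¹ := by
  induction j generalizing i with
  | zero =>
    obtain rfl : i = k := by omega
    simp [dd, db, mul_assoc]
  | succ j ih =>
    have := ih (i := i + 1) (by omega)
    have e1 : (db s (i + 1))⁻¹ = (db s (i + 2))⁻¹ * s (i + 1) := by
      rw [show db s (i + 2) = s (i + 1) * db s (i + 1) from rfl]; group
    have e2 : (db s i)⁻¹ = (db s (i + 1))⁻¹ * s i := by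
      rw [show db s (i + 1) = s i * db s i from rfl]; group
    rw [e2, ← mul_assoc, ← this, e1]
    simp only [mul_assoc]
    rw [h.dd_shift (by omega) hk]

theorem dd_pow (h : BrSeq N s) {k : ℕ} (hk : k + 1 ≤ N) (j : ℕ) (hj : j ≤ k + 1) :
    dd s (k + 1) ^ j = dd s k ^ j * db s (k + 1) * (db s (k + 1 - j))⁻¹ := by
  induction j with
  | zero => simp
  | succ j ih =>
    have := h.dd_pow_aux hk j (i := k - j) (by omega)
    rw [pow_succ, ih (by omega), show k + 1 - j = k - j + 1 by omega,
      show k + 1 - (j + 1) = k - j by omega, mul_assoc, mul_assoc, ← mul_assoc (db s _), this,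
      pow_succ]
    simp only [mul_assoc]

theorem dd_pow_top (h : BrSeq N s) {k : ℕ} (hk : k + 1 ≤ N) :
    dd s (k + 1) ^ (k + 2) = dd s k ^ (k + 1) * db s (k + 1) * dd s (k + 1) := by
  rw [pow_succ, h.dd_pow hk (k + 1) le_rfl]
  simp [db]

theorem db_db (h : BrSeq N s) {k : ℕ} (hk : k + 1 ≤ N) :
    db s k * db s (k + 1) * s 0 = s k * (db s k * db s (k + 1)) := by
  induction k with
  | zero => simp [db]
  | succ k ih =>
    have ih := ih (by omega)
    have e : db s (k + 1) * db s (k + 2) = s k * s (k + 1) * (db s k * db s (k + 1)) := by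
      rw [show db s (k + 2) = s (k + 1) * db s (k + 1) from rfl]
      conv_lhs => rw [show db s (k + 1) = s k * db s k from rfl]
      rw [show s k * db s k * (s (k + 1) * (s k * db s k)) = s k * (db s k * s (k + 1)) * (s k * db s k)
        by group, h.db_comm (by omega) (by omega)]
      rw [show db s (k + 1) = s k * db s k from rfl]
      group
    rw [e, mul_assoc, ih, ← mul_assoc, h.braid k (by omega)]
    simp only [mul_assoc]

theorem HT_flip (h : BrSeq N s) {k i : ℕ} (hk : k ≤ N) (hi : i < k) :
    HT s k * s i = s (k - 1 - i) * HT s k := by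
  induction k generalizing i with
  | zero => omega
  | succ k ih =>
    rcases i with _ | i
    · rcases k with _ | k
      · simp [HT, db]
      · have := h.db_db (k := k + 1) hk
        rw [HT, HT, mul_assoc, mul_assoc, ← mul_assoc (db s _), this, ← mul_assoc,
          h.HT_comm (by omega) (by omega)]
        simp only [mul_assoc]; rfl
    · rw [HT, mul_assoc, h.db_shift (by omega) hk, ← mul_assoc, ih (by omega) (by omega),
        show k + 1 - 1 - (i + 1) = k - 1 - i by omega, mul_assoc]

theorem HT_dd (h : BrSeq N s) {k : ℕ} (hk : k ≤ N) (j : ℕ) (hj : j ≤ k) :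
    HT s k * dd s j = db s k * (db s (k - j))⁻¹ * HT s k := by
  induction j with
  | zero => simp [dd]
  | succ j ih =>
    rw [dd, ← mul_assoc, ih (by omega), mul_assoc, h.HT_flip hk (by omega), ← mul_assoc]
    congr 1
    obtain ⟨i, hi⟩ : ∃ i, k - j = i + 1 := ⟨k - j - 1, by omega⟩
    rw [hi, show k - 1 - j = i by omega, show k - (j + 1) = i by omega]
    simp [db, mul_assoc]

theorem HT_sq (h : BrSeq N s) {k : ℕ} (hk : k ≤ N) : HT s k ^ 2 = dd s k ^ (k + 1) := by
  induction k with
  | zero => simp [HT, dd]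
  | succ k ih =>
    have h1 := h.HT_dd hk (k + 1) le_rfl
    simp only [Nat.sub_self, db, inv_one, mul_one] at h1
    rw [h.dd_pow_top hk, ← ih (by omega), sq, sq, mul_assoc (HT s k * HT s k), mul_assoc (HT s k),
      ]
    have : db s (k + 1) * HT s (k + 1) = HT s k * (db s (k + 1) * dd s (k + 1)) := by
      rw [show db s (k + 1) = s k * db s k from rfl, ← h1, HT, mul_assoc, db]
    rw [← this, ← mul_assoc]; rfl

end BrSeq

section braidBasics

variable (n : ℕ)

theorem sigmaN_comm (i j : ℕ) (h : i + 1 < j) :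
    sigmaN n i * sigmaN n j = sigmaN n j * sigmaN n i := by
  unfold sigmaN
  split_ifs with h1 h2
  · have : (PresentedGroup.mk (braidRels n)) (FreeGroup.of ⟨i, h1⟩ * FreeGroup.of ⟨j, h2⟩ *
        (FreeGroup.of ⟨j, h2⟩ * FreeGroup.of ⟨i, h1⟩)⁻¹) = 1 :=
      PresentedGroup.one_of_mem (Or.inl ⟨⟨i, h1⟩, ⟨j, h2⟩, h, rfl⟩)
    rw [map_mul, map_inv, mul_inv_eq_one, map_mul, map_mul] at this
    exact this
  all_goals simp

theorem sigmaN_braid (i : ℕ) (h : i + 1 < n - 1) :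
    sigmaN n i * sigmaN n (i + 1) * sigmaN n i = sigmaN n (i + 1) * sigmaN n i * sigmaN n (i + 1) := by
  unfold sigmaN
  rw [dif_pos (show i < n - 1 by omega), dif_pos h]
  have : (PresentedGroup.mk (braidRels n)) (FreeGroup.of ⟨i, by omega⟩ * FreeGroup.of ⟨i + 1, h⟩ *
        FreeGroup.of ⟨i, by omega⟩ *
        (FreeGroup.of ⟨i + 1, h⟩ * FreeGroup.of ⟨i, by omega⟩ * FreeGroup.of ⟨i + 1, h⟩)⁻¹) = 1 :=
    PresentedGroup.one_of_mem (Or.inr ⟨⟨i, by omega⟩, ⟨i + 1, h⟩, rfl, rfl⟩)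
  rw [map_mul, map_inv, mul_inv_eq_one, map_mul, map_mul, map_mul, map_mul] at this
  exact this

theorem sigmaN_brSeq : BrSeq (n - 1) (sigmaN n) :=
  ⟨fun i j h _ => sigmaN_comm n i j h, fun i h => sigmaN_braid n i h⟩

variable {n}

/-- Universal property of the braid group. -/
def braidLift {G : Type*} [Group G] (f : ℕ → G) (hf : BrSeq (n - 1) f) : BraidGroup n →* G :=
  PresentedGroup.toGroup (f := fun i : Fin (n - 1) => f i) (by
    rintro r (⟨i, j, hij, rfl⟩ | ⟨i, j, hij, rfl⟩)
    · simp only [map_mul, map_inv, FreeGroup.lift_apply_of, mul_inv_eq_one]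
      exact hf.comm _ _ hij j.2
    · simp only [map_mul, map_inv, FreeGroup.lift_apply_of, mul_inv_eq_one]
      rw [hij]
      exact hf.braid _ (by omega))

theorem braidLift_sigmaN {G : Type*} [Group G] (f : ℕ → G) (hf : BrSeq (n - 1) f) (i : ℕ)
    (hi : i < n - 1) : braidLift f hf (sigmaN n i) = f i := by
  unfold sigmaN braidLift
  rw [dif_pos hi]
  exact PresentedGroup.toGroup.of _

theorem braid_closure : Subgroup.closure {x | ∃ i < n - 1, x = sigmaN n i} = ⊤ := by
  rw [eq_top_iff, ← PresentedGroup.closure_range_of]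
  apply Subgroup.closure_mono
  rintro _ ⟨i, rfl⟩
  refine ⟨i, i.2, ?_⟩
  simp [sigmaN, braidGen]

theorem braid_induction {P : BraidGroup n → Prop} (x : BraidGroup n)
    (hs : ∀ i < n - 1, P (sigmaN n i)) (h1 : P 1) (hm : ∀ x y, P x → P y → P (x * y))
    (hi : ∀ x, P x → P x⁻¹) : P x := by
  have hx : x ∈ Subgroup.closure {x | ∃ i < n - 1, x = sigmaN n i} := by
    rw [braid_closure]; trivial
  induction hx using Subgroup.closure_induction with
  | mem x hx => obtain ⟨i, hi, rfl⟩ := hx; exact hs i hi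
  | one => exact h1
  | mul x y _ _ hx hy => exact hm x y hx hy
  | inv x _ hx => exact hi x hx

theorem braid_hom_ext {G : Type*} [Group G] {f g : BraidGroup n →* G}
    (h : ∀ i < n - 1, f (sigmaN n i) = g (sigmaN n i)) : f = g := by
  refine MonoidHom.ext fun x => ?_
  induction x using braid_induction with
  | hs i hi => exact h i hi
  | h1 => simp
  | hm x y hx hy => simp [hx, hy]
  | hi x hx => simp [hx]

variable (n)

theorem list_prod_dd {G : Type*} [Group G] (s : ℕ → G) (k : ℕ) :
    ((List.range k).map s).prod = BrSeq.dd s k := by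
  induction k with
  | zero => rfl
  | succ k ih => simp [List.range_succ, ih, BrSeq.dd]

theorem descRun_eq (k : ℕ) : descRun n k = BrSeq.db (sigmaN n) (k + 1) := by
  unfold descRun
  generalize k + 1 = k
  induction k with
  | zero => rfl
  | succ k ih => simpa [List.range_succ, BrSeq.db] using ih

theorem halfTwist_eq : halfTwist n = BrSeq.HT (sigmaN n) (n - 1) := by
  unfold halfTwist
  suffices h : ∀ k, ((List.range k).map (descRun n)).prod = BrSeq.HT (sigmaN n) k from h _
  intro k
  induction k with
  | zero => rfl
  | succ k ih => simp [List.range_succ, ih, BrSeq.HT, descRun_eq]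

theorem deltaBraid_eq : deltaBraid n = BrSeq.dd (sigmaN n) (n - 1) := list_prod_dd _ _

/-- The full twist. -/
def zBraid : BraidGroup n := deltaBraid n ^ (n - 1 + 1)

theorem zBraid_comm (x : BraidGroup n) : Commute (zBraid n) x := by
  induction x using braid_induction with
  | hs i hi => rw [zBraid, deltaBraid_eq]; exact (sigmaN_brSeq n).z_comm hi
  | h1 => exact Commute.one_right _
  | hm x y hx hy => exact hx.mul_right hy
  | hi x hx => exact hx.inv_right

theorem halfTwist_sq : halfTwist n ^ 2 = zBraid n := by
  rw [zBraid, deltaBraid_eq, halfTwist_eq, (sigmaN_brSeq n).HT_sq le_rfl]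

theorem eps_pow_z : epsBraid n ^ (n - 1) = zBraid n := by
  rw [epsBraid, zBraid, deltaBraid_eq, (sigmaN_brSeq n).eps_pow_eq]

end braidBasics

/-- Fixed point theorem for order automorphisms of finite order on a Garside-type group. -/
theorem garside_fixed_point {M G : Type*} [Monoid M] [Group G] (ρ : M →* G)
    (hinj : Function.Injective ρ)
    (hlub : ∀ x y : M, ∃ j, x ∣ j ∧ y ∣ j ∧ ∀ w, x ∣ w → y ∣ w → j ∣ w)
    (hunit : ∀ x y : M, x * y = 1 → x = 1)
    (Z : M) (hZ : ∀ g, Commute (ρ Z) g) (hgen : ∀ g : G, ∃ (m : M) (k : ℕ), g * ρ Z ^ k = ρ m)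
    (D : G) (hD : ∀ m, ∃ m', D⁻¹ * ρ m * D = ρ m') (β : G) (q : ℕ) (hq : 0 < q)
    (hT : ∀ g, β ^ q * g * D ^ q = g) : ∃ h, β * h * D = h := by
  let le : G → G → Prop := fun g h => ∃ m, h = g * ρ m
  have le_refl : ∀ g, le g g := fun g => ⟨1, by simp⟩
  have le_trans : ∀ g h k, le g h → le h k → le g k := by
    rintro g h k ⟨m, rfl⟩ ⟨m', rfl⟩
    exact ⟨m * m', by simp [mul_assoc]⟩
  have le_antisymm : ∀ g h, le g h → le h g → g = h := by
    rintro g h ⟨m, rfl⟩ ⟨m', h'⟩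
    have : ρ (m * m') = ρ 1 := by
      rw [mul_assoc, left_eq_mul] at h'
      simpa using h'
    rw [hunit m m' (hinj this)]; simp
  have lub : ∀ g h, ∃ j, le g j ∧ le h j ∧ ∀ u, le g u → le h u → le j u := by
    intro g h
    obtain ⟨x0, k1, hx⟩ := hgen g
    obtain ⟨y0, k2, hy⟩ := hgen h
    have hx' : g * ρ Z ^ (k1 + k2) = ρ (x0 * Z ^ k2) := by
      rw [pow_add, ← mul_assoc, hx]; simp
    have hy' : h * ρ Z ^ (k1 + k2) = ρ (y0 * Z ^ k1) := by
      rw [add_comm k1, pow_add, ← mul_assoc, hy]; simp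
    obtain ⟨j, hxj, hyj, hj⟩ := hlub (x0 * Z ^ k2) (y0 * Z ^ k1)
    have key : ∀ (g u : G) (x w : M) (c : G), Commute c g → (∀ u, Commute c u) → g * c = ρ x →
        u * c = ρ w → (x ∣ w ↔ le g u) := by
      intro g u x w c hcg hc hgx huw
      constructor
      · rintro ⟨v, rfl⟩
        refine ⟨v, ?_⟩
        rw [map_mul, ← hgx, mul_assoc, (hc _).eq, ← mul_assoc] at huw
        exact mul_right_cancel huw
      · rintro ⟨v, rfl⟩
        refine ⟨v, hinj ?_⟩
        rw [map_mul, ← hgx, ← huw, mul_assoc, mul_assoc, (hc _).eq]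
    have hc : ∀ u, Commute (ρ Z ^ (k1 + k2)) u := fun u => (hZ u).pow_left _
    have hjj : (ρ j * (ρ Z ^ (k1 + k2))⁻¹) * ρ Z ^ (k1 + k2) = ρ j := by simp
    refine ⟨ρ j * (ρ Z ^ (k1 + k2))⁻¹, (key _ _ _ _ _ (hc _) hc hx' hjj).1 hxj,
      (key _ _ _ _ _ (hc _) hc hy' hjj).1 hyj, ?_⟩
    intro u hgu hhu
    have hu : ∃ w, u * ρ Z ^ (k1 + k2) = ρ w := by
      obtain ⟨m, rfl⟩ := hgu
      refine ⟨x0 * Z ^ k2 * m, ?_⟩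
      rw [mul_assoc, ← (hc _).eq, ← mul_assoc, hx', ← map_mul]
    obtain ⟨w, hw⟩ := hu
    exact (key _ _ _ _ _ (hc _) hc hjj hw).1 (hj w ((key _ _ _ _ _ (hc _) hc hx' hw).2 hgu)
      ((key _ _ _ _ _ (hc _) hc hy' hw).2 hhu))
  have mono : ∀ g h, le g h → le (β * g * D) (β * h * D) := by
    rintro g h ⟨m, rfl⟩
    obtain ⟨m', hm'⟩ := hD m
    refine ⟨m', ?_⟩
    rw [← hm']; group
  have lubs : ∀ k : ℕ, ∃ h, (∀ i ≤ k, le (β ^ i * D ^ i) h) ∧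
      ∀ u, (∀ i ≤ k, le (β ^ i * D ^ i) u) → le h u := by
    intro k
    induction k with
    | zero =>
      refine ⟨1, ?_, ?_⟩
      · intro i hi
        obtain rfl : i = 0 := by omega
        simpa using le_refl 1
      · intro u hu
        simpa using hu 0 le_rfl
    | succ k ih =>
      obtain ⟨h, h1, h2⟩ := ih
      obtain ⟨j, hj1, hj2, hj3⟩ := lub h (β ^ (k + 1) * D ^ (k + 1))
      refine ⟨j, ?_, ?_⟩
      · intro i hi
        rcases Nat.lt_or_ge i (k + 1) with h3 | h3
        · exact le_trans _ _ _ (h1 i (by omega)) hj1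
        · obtain rfl : i = k + 1 := by omega
          exact hj2
      · intro u hu
        exact hj3 u (h2 u fun i hi => hu i (by omega)) (hu _ le_rfl)
  obtain ⟨h, h1, h2⟩ := lubs (q - 1)
  refine ⟨h, ?_⟩
  have hle : le h (β * h * D) := by
    apply h2
    intro i hi
    rcases i with _ | i
    · have h3 := mono _ _ (h1 (q - 1) le_rfl)
      have h4 := hT 1
      have : β * (β ^ (q - 1) * D ^ (q - 1)) * D = β ^ 0 * D ^ 0 := by
        rw [← mul_assoc, ← pow_succ', mul_assoc, ← pow_succ, show q - 1 + 1 = q by omega]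
        simpa using h4
      rwa [this] at h3
    · have h3 := mono _ _ (h1 i (by omega))
      have : β * (β ^ i * D ^ i) * D = β ^ (i + 1) * D ^ (i + 1) := by
        rw [pow_succ' β, pow_succ D]; group
      rwa [this] at h3
  have hstep : ∀ i : ℕ, le (β ^ i * h * D ^ i) (β ^ (i + 1) * h * D ^ (i + 1)) := by
    intro i
    induction i with
    | zero => simpa using hle
    | succ i ih =>
      have := mono _ _ ih
      rw [show β ^ (i + 1) * h * D ^ (i + 1) = β * (β ^ i * h * D ^ i) * D by
        rw [pow_succ' β, pow_succ D]; group,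
        show β ^ (i + 1 + 1) * h * D ^ (i + 1 + 1) = β * (β ^ (i + 1) * h * D ^ (i + 1)) * D by
        rw [pow_succ' β, pow_succ D]; group]
      exact this
  have hall : ∀ i : ℕ, le (β * h * D) (β ^ (i + 1) * h * D ^ (i + 1)) := by
    intro i
    induction i with
    | zero => simpa using le_refl _
    | succ i ih => exact le_trans _ _ _ ih (hstep _)
  have := hall (q - 1)
  rw [show q - 1 + 1 = q by omega, hT] at this
  exact le_antisymm _ _ this hle

/-- A complementation with the cube property. -/
structure LAlg (S : Type*) where
  e : S
  cmp : S → S → S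
  e_cmp : ∀ a, cmp e a = a
  cmp_e : ∀ a, cmp a e = e
  cmp_self : ∀ a, cmp a a = e
  cube : ∀ a b c, cmp (cmp a b) (cmp a c) = cmp (cmp b a) (cmp b c)

namespace LAlg

universe u

variable {S : Type u} (A : LAlg S)

/-- Defining relations -/
inductive Rel : FreeMonoid S → FreeMonoid S → Prop
  | one : Rel (FreeMonoid.of A.e) 1
  | comp (a b : S) : Rel (FreeMonoid.of a * FreeMonoid.of (A.cmp a b))
      (FreeMonoid.of b * FreeMonoid.of (A.cmp b a))

/-- The structure monoid -/
abbrev Mon := PresentedMonoid A.Rel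

/-- generators -/
def of (a : S) : A.Mon := PresentedMonoid.of A.Rel a

theorem of_e : A.of A.e = 1 := PresentedMonoid.mk_eq_mk_of_rel Rel.one

theorem of_comp (a b : S) : A.of a * A.of (A.cmp a b) = A.of b * A.of (A.cmp b a) :=
  PresentedMonoid.mk_eq_mk_of_rel (Rel.comp a b)

theorem mon_induction {P : A.Mon → Prop} (m : A.Mon) (h1 : P 1)
    (hs : ∀ a m, P m → P (A.of a * m)) : P m := by
  obtain ⟨w, rfl⟩ := PresentedMonoid.surjective_mk m
  induction w using FreeMonoid.inductionOn' with
  | one => exact h1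
  | of_mul a w ih => exact hs a _ ih

/-- lift -/
def lift {N : Type*} [Monoid N] (f : S → N) (h1 : f A.e = 1)
    (h2 : ∀ a b, f a * f (A.cmp a b) = f b * f (A.cmp b a)) : A.Mon →* N :=
  PresentedMonoid.lift f (by
    rintro _ _ (_ | ⟨a, b⟩)
    · simpa using h1
    · simpa using h2 a b)

theorem lift_of {N : Type*} [Monoid N] (f : S → N) (h1 : f A.e = 1)
    (h2 : ∀ a b, f a * f (A.cmp a b) = f b * f (A.cmp b a)) (a : S) :
    A.lift f h1 h2 (A.of a) = f a := rfl

/-- Transducers. -/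
structure Trans (S M : Type*) where
  fn : S → M × S

namespace Trans


@[ext] theorem ext_fn {M : Type*} {F G : Trans S M} (h : ∀ a, F.fn a = G.fn a) : F = G := by
  cases F; cases G; congr; exact funext h

variable {M : Type*} [Monoid M]

instance : Monoid (Trans S M) where
  mul F G := ⟨fun a => ((F.fn a).1 * (G.fn (F.fn a).2).1, (G.fn (F.fn a).2).2)⟩
  one := ⟨fun a => (1, a)⟩
  mul_assoc F G H := by
    ext1 a
    exact Prod.ext (mul_assoc _ _ _) rfl
  one_mul F := by
    ext1 a
    exact Prod.ext (one_mul _) rfl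
  mul_one F := by
    ext1 a
    exact Prod.ext (mul_one _) rfl

theorem mul_fn (F G : Trans S M) (a : S) :
    (F * G).fn a = ((F.fn a).1 * (G.fn (F.fn a).2).1, (G.fn (F.fn a).2).2) := rfl

theorem one_fn (a : S) : (1 : Trans S M).fn a = (1, a) := rfl

end Trans

/-- The transducer action. -/
def Phi : A.Mon →* Trans S A.Mon :=
  A.lift (fun b => ⟨fun a => (A.of (A.cmp a b), A.cmp b a)⟩)
    (by
      ext1 a
      simp only [A.cmp_e, A.e_cmp, A.of_e]; rfl)
    (by
      intro b c
      ext1 a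
      simp only [Trans.mul_fn]
      rw [A.cube b a c, A.cube c a b, A.of_comp, A.cube b c a])

/-- residue -/
def D (a : S) (m : A.Mon) : A.Mon := ((A.Phi m).fn a).1

/-- state -/
def R (a : S) (m : A.Mon) : S := ((A.Phi m).fn a).2

theorem D_one (a : S) : A.D a 1 = 1 := by simp [D, Trans.one_fn]
theorem R_one (a : S) : A.R a 1 = a := by simp [R, Trans.one_fn]
theorem D_mul (a : S) (x y) : A.D a (x * y) = A.D a x * A.D (A.R a x) y := by
  simp [D, R, Trans.mul_fn]
theorem R_mul (a : S) (x y) : A.R a (x * y) = A.R (A.R a x) y := by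
  simp [R, Trans.mul_fn]
theorem D_of (a b : S) : A.D a (A.of b) = A.of (A.cmp a b) := rfl
theorem R_of (a b : S) : A.R a (A.of b) = A.cmp b a := rfl

theorem DR_e (m : A.Mon) : A.D A.e m = m ∧ A.R A.e m = A.e := by
  induction m using A.mon_induction with
  | h1 => exact ⟨A.D_one _, A.R_one _⟩
  | hs a m ih => rw [D_mul, R_mul, D_of, R_of, A.cmp_e, A.e_cmp, ih.1, ih.2]; exact ⟨rfl, rfl⟩

theorem D_of_mul (a : S) (m) : A.D a (A.of a * m) = m := by
  rw [D_mul, D_of, R_of, A.cmp_self, A.of_e, one_mul, (A.DR_e m).1]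

theorem mul_left_cancel' (x y z : A.Mon) (h : x * y = x * z) : y = z := by
  induction x using A.mon_induction with
  | h1 => simpa using h
  | hs a m ih =>
    apply ih
    rw [mul_assoc, mul_assoc] at h
    rw [← A.D_of_mul a (m * y), h, D_of_mul]

theorem of_mul_D (a : S) (m) : A.of a * A.D a m = m * A.of (A.R a m) := by
  induction m using A.mon_induction generalizing a with
  | h1 => simp [D_one, R_one]
  | hs b m ih => rw [D_mul, R_mul, D_of, R_of, ← mul_assoc, of_comp, mul_assoc, ih, mul_assoc]

theorem dvd_aux (a : S) (m w : A.Mon) (h1 : A.of a ∣ w) (h2 : m ∣ w) : A.of a * A.D a m ∣ w := by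
  obtain ⟨u, rfl⟩ := h1
  obtain ⟨v, hv⟩ := h2
  have := A.D_of_mul a u
  rw [hv, D_mul] at this
  exact ⟨A.D (A.R a m) v, by rw [mul_assoc, this]⟩

theorem exists_lub (x y : A.Mon) : ∃ j, x ∣ j ∧ y ∣ j ∧ ∀ w, x ∣ w → y ∣ w → j ∣ w := by
  induction x using A.mon_induction generalizing y with
  | h1 => exact ⟨y, one_dvd _, dvd_rfl, fun w _ h => h⟩
  | hs a x ih =>
    obtain ⟨j, h1, h2, h3⟩ := ih (A.D a y)
    refine ⟨A.of a * j, mul_dvd_mul_left _ h1, ?_, ?_⟩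
    · refine dvd_trans ?_ (mul_dvd_mul_left _ h2)
      rw [of_mul_D]; exact dvd_mul_right _ _
    · intro w hx hy
      have h4 : A.of a ∣ w := dvd_trans (dvd_mul_right _ _) hx
      have h5 := A.dvd_aux a y w h4 hy
      obtain ⟨w, rfl⟩ := h4
      refine mul_dvd_mul_left _ (h3 w ?_ ?_)
      · obtain ⟨c, hc⟩ := hx
        exact ⟨c, A.mul_left_cancel' (A.of a) _ _ (by rw [hc, mul_assoc])⟩
      · obtain ⟨c, hc⟩ := h5
        exact ⟨c, A.mul_left_cancel' (A.of a) _ _ (by rw [hc, mul_assoc])⟩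

theorem no_units (len : S → ℕ) (hl0 : ∀ a, len a = 0 → a = A.e) (hle : len A.e = 0)
    (hl : ∀ a b, len a + len (A.cmp a b) = len b + len (A.cmp b a)) (x y : A.Mon)
    (h : x * y = 1) : x = 1 := by
  let L : A.Mon →* Multiplicative ℕ := A.lift (fun a => Multiplicative.ofAdd (len a))
    (by simp [hle]) (by intro a b; rw [← ofAdd_add, ← ofAdd_add, hl])
  have h0 : (L x).toAdd = 0 := by
    have : (L (x * y)).toAdd = 0 := by rw [h, map_one]; rfl
    rw [map_mul, toAdd_mul] at this
    omega
  clear h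
  induction x using A.mon_induction with
  | h1 => rfl
  | hs a m ih =>
    rw [map_mul, toAdd_mul] at h0
    have h1 : len a = 0 := by
      have : (L (A.of a)).toAdd = len a := rfl
      omega
    rw [ih (by omega), hl0 a h1, of_e, one_mul]

/-- Top element data. -/
structure Top (d : S) (N : ℕ) : Prop where
  le : ∀ a, A.cmp d a = A.e
  per : ∀ a, (fun a => A.cmp (A.cmp a d) d)^[N] a = a

variable {A} {d : S} {N : ℕ}

theorem Top.of_mul (h : A.Top d N) (a : S) : A.of a * A.of (A.cmp a d) = A.of d := by
  rw [of_comp, h.le, of_e, mul_one]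

theorem Top.of_mul_d (h : A.Top d N) (a : S) :
    A.of a * A.of d = A.of d * A.of (A.cmp (A.cmp a d) d) := by
  conv_rhs => rw [← h.of_mul a, mul_assoc, h.of_mul (A.cmp a d)]

theorem Top.of_mul_pow (h : A.Top d N) (k : ℕ) (a : S) :
    A.of a * A.of d ^ k = A.of d ^ k * A.of ((fun a => A.cmp (A.cmp a d) d)^[k] a) := by
  induction k generalizing a with
  | zero => simp
  | succ k ih =>
    rw [pow_succ', ← mul_assoc, h.of_mul_d, mul_assoc, ih, Function.iterate_succ_apply, mul_assoc]

theorem Top.central (h : A.Top d N) (m : A.Mon) : Commute (A.of d ^ N) m := by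
  induction m using A.mon_induction with
  | h1 => exact Commute.one_right _
  | hs a m ih =>
    refine Commute.mul_right ?_ ih
    have := h.of_mul_pow N a
    rw [h.per] at this
    exact this.symm

theorem Top.dvd_pow (h : A.Top d N) (m : A.Mon) : ∃ k, m ∣ A.of d ^ k := by
  induction m using A.mon_induction with
  | h1 => exact ⟨0, one_dvd _⟩
  | hs a m ih =>
    obtain ⟨k, c, hc⟩ := ih
    refine ⟨k + 1, c * A.of ((fun a => A.cmp (A.cmp a d) d)^[k] (A.cmp a d)), ?_⟩
    rw [← mul_assoc, mul_assoc (A.of a), ← hc, mul_assoc, ← h.of_mul_pow, ← mul_assoc, h.of_mul,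
      pow_succ']

theorem Top.dvd_powZ (h : A.Top d (N + 1)) (m : A.Mon) : ∃ k, m ∣ (A.of d ^ (N + 1)) ^ k := by
  obtain ⟨k, c, hk⟩ := h.dvd_pow m
  refine ⟨k, c * A.of d ^ (N * k), ?_⟩
  rw [← mul_assoc, ← hk, ← pow_add, ← pow_mul]
  congr 1; ring

theorem Top.exists_group (h : A.Top d (N + 1)) : ∃ (L : Type u) (_ : Monoid L) (ι : A.Mon →* L),
    Function.Injective ι ∧ ∀ m, IsUnit (ι m) := by
  have hc : ∀ (s : Submonoid.powers (A.of d ^ (N + 1))) (m : A.Mon), Commute (s : A.Mon) m := by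
    rintro ⟨_, k, rfl⟩ m
    exact (h.central m).pow_left k
  let _ : OreLocalization.OreSet (Submonoid.powers (A.of d ^ (N + 1))) :=
    { ore_right_cancel := fun r₁ r₂ s hs => ⟨s, by rw [(hc s r₁).eq, hs, (hc s r₂).eq]⟩
      oreNum := fun r _ => r
      oreDenom := fun _ s => s
      ore_eq := fun r s => (hc s r).eq }
  let ι : A.Mon →* OreLocalization (Submonoid.powers (A.of d ^ (N + 1))) A.Mon :=
    OreLocalization.numeratorHom
  refine ⟨OreLocalization (Submonoid.powers (A.of d ^ (N + 1))) A.Mon, inferInstance,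
    ι, ?_, ?_⟩
  · intro x y hxy
    simp only [ι, OreLocalization.numeratorHom_apply, OreLocalization.oreDiv_eq_iff] at hxy
    obtain ⟨u, v, h1, h2⟩ := hxy
    simp only [OneMemClass.coe_one, mul_one] at h2
    have h3 : (u : A.Mon) * y = u * x := by
      rw [show (u : A.Mon) * y = v * x from h1, ← h2]
    exact (A.mul_left_cancel' _ _ _ h3).symm
  · intro m
    obtain ⟨k, c, hk⟩ := h.dvd_powZ m
    have hu : IsUnit (ι ((A.of d ^ (N + 1)) ^ k)) :=
      OreLocalization.numerator_isUnit (S := Submonoid.powers (A.of d ^ (N + 1)))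
        ⟨(A.of d ^ (N + 1)) ^ k, ⟨k, rfl⟩⟩
    have hcm : c * m = (A.of d ^ (N + 1)) ^ k := by
      apply A.mul_left_cancel' m
      rw [← mul_assoc, ← hk, ((h.central m).pow_left k).eq]
    have h1 := hu
    rw [hk, map_mul] at h1
    have h2 := hu
    rw [← hcm, map_mul] at h2
    obtain ⟨u, hu⟩ := h1
    obtain ⟨v, hv⟩ := h2
    rw [isUnit_iff_exists_and_exists]
    refine ⟨⟨ι c * ↑(u⁻¹), ?_⟩,
      ⟨↑(v⁻¹) * ι c, ?_⟩⟩
    · rw [← mul_assoc, ← hu, Units.mul_inv]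
    · rw [mul_assoc, ← hv, Units.inv_mul]

end LAlg

/-- A conjugation invariant length function on a group. -/
structure LenFn (W : Type*) [Group W] where
  l : W → ℕ
  l_one : l 1 = 0
  eq_one : ∀ a, l a = 0 → a = 1
  mul_le : ∀ a b, l (a * b) ≤ l a + l b
  conj : ∀ g a, l (g * a * g⁻¹) = l a

namespace LenFn

variable {W : Type*} [Group W] (F : LenFn W)

/-- the absolute order -/
def le (a b : W) : Prop := F.l a + F.l (a⁻¹ * b) = F.l b

theorem le_refl (a : W) : F.le a a := by simp [le, F.l_one]

theorem one_le (a : W) : F.le 1 a := by simp [le, F.l_one]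

variable {F} {a b p r J u c d : W}

theorem le.trans (h1 : F.le a b) (h2 : F.le b c) : F.le a c := by
  unfold le at *
  have h3 := F.mul_le (a⁻¹ * b) (b⁻¹ * c)
  have h4 := F.mul_le a (a⁻¹ * c)
  simp only [mul_inv_cancel_left, mul_assoc] at h3 h4
  omega

theorem le.antisymm (h1 : F.le a b) (h2 : F.le b a) : a = b := by
  unfold le at *
  have : F.l (a⁻¹ * b) = 0 := by omega
  exact (inv_mul_eq_one.1 (F.eq_one _ this))

theorem le.translate (h1 : F.le a p) (h2 : F.le a r) : F.le (a⁻¹ * p) (a⁻¹ * r) ↔ F.le p r := by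
  unfold le at *
  have : (a⁻¹ * p)⁻¹ * (a⁻¹ * r) = p⁻¹ * r := by group
  rw [this]; omega

theorem le.mul_left (h1 : F.le a J) (h2 : F.le u (a⁻¹ * J)) : F.le a (a * u) ∧ F.le (a * u) J := by
  unfold le at *
  have h3 := F.mul_le a u
  have h4 := F.mul_le (a * u) ((a * u)⁻¹ * J)
  have e : (a * u)⁻¹ * J = u⁻¹ * (a⁻¹ * J) := by group
  rw [mul_inv_cancel_left, e] at h4
  rw [e, inv_mul_cancel_left]
  omega

theorem le.compl (h : F.le a c) : F.le (a⁻¹ * c) c := by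
  unfold le at *
  have e : (a⁻¹ * c)⁻¹ * c = c⁻¹ * a * c⁻¹⁻¹ := by group
  rw [e, F.conj]; omega

theorem le.sub (h1 : F.le a b) (h2 : F.le b c) : F.le (a⁻¹ * b) c :=
  ((h1.translate (h1.trans h2)).2 h2).trans (h1.trans h2).compl

variable (F)

/-- `w` is the join of `y` and `z` relative to `d`. -/
def IsJoin (d y z w : W) : Prop :=
  F.le w d ∧ F.le y w ∧ F.le z w ∧ ∀ a, F.le a d → F.le y a → F.le z a → F.le w a

variable {F}

theorem IsJoin.translate {b y z w : W} (hb : F.le b d) (hy : F.le b y) (hz : F.le b z)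
    (h : F.IsJoin (b⁻¹ * d) (b⁻¹ * y) (b⁻¹ * z) w) : F.IsJoin d y z (b * w) := by
  obtain ⟨h1, h2, h3, h4⟩ := h
  obtain ⟨h5, h6⟩ := hb.mul_left h1
  refine ⟨h6, ?_, ?_, ?_⟩
  · rw [← hy.translate h5]; simpa using h2
  · rw [← hz.translate h5]; simpa using h3
  · intro a ha hya hza
    have hba := hy.trans hya
    rw [← h5.translate hba]
    simpa using h4 (b⁻¹ * a) ((hba.translate hb).2 ha) ((hy.translate hba).2 hya)
      ((hz.translate hba).2 hza)

/-- Lattice criterion. -/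
theorem exists_join (At : W → Prop) (hAt1 : ∀ t, At t → t ≠ 1)
    (hAt : ∀ a, F.le a c → a ≠ 1 → ∃ t, At t ∧ F.le t a)
    (hj : ∀ t s, At t → At s → F.le t c → F.le s c → ∃ u, F.IsJoin c t s u)
    (k : ℕ) : ∀ d, F.le d c → F.l d ≤ k → ∀ y z, F.le y d → F.le z d → ∃ w, F.IsJoin d y z w := by
  induction k with
  | zero =>
    intro d hdc hd y z hy hz
    have : d = 1 := F.eq_one _ (by omega)
    subst this
    obtain rfl := hy.antisymm (F.one_le _)
    obtain rfl := hz.antisymm (F.one_le _)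
    exact ⟨1, F.le_refl _, F.le_refl _, F.le_refl _, fun a _ h _ => h⟩
  | succ k ih =>
    intro d hdc hd y z hy hz
    by_cases hy1 : y = 1
    · subst hy1
      exact ⟨z, hz, F.one_le _, F.le_refl _, fun a _ _ h => h⟩
    by_cases hz1 : z = 1
    · subst hz1
      exact ⟨y, hy, F.le_refl _, F.one_le _, fun a _ h _ => h⟩
    have step : ∀ b y z, b ≠ 1 → F.le b d → F.le b y → F.le b z → F.le y d → F.le z d →
        ∃ w, F.IsJoin d y z w := by
      intro b y z hb hbd hby hbz hyd hzd
      have hlb : F.l b ≠ 0 := fun h => hb (F.eq_one _ h)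
      have hl : F.l (b⁻¹ * d) ≤ k := by
        have : F.l b + F.l (b⁻¹ * d) = F.l d := hbd
        omega
      obtain ⟨w, hw⟩ := ih (b⁻¹ * d) (hbd.sub hdc) hl (b⁻¹ * y) (b⁻¹ * z)
        ((hby.translate hbd).2 hyd) ((hbz.translate hbd).2 hzd)
      exact ⟨b * w, hw.translate hbd hby hbz⟩
    obtain ⟨t, ht, hty⟩ := hAt y (hy.trans hdc) hy1
    obtain ⟨s, hs, hsz⟩ := hAt z (hz.trans hdc) hz1
    obtain ⟨u, hu1, hu2, hu3, hu4⟩ := hj t s ht hs ((hty.trans hy).trans hdc)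
      ((hsz.trans hz).trans hdc)
    have hud : F.le u d := hu4 d hdc (hty.trans hy) (hsz.trans hz)
    obtain ⟨p, hp1, hp2, hp3, hp4⟩ := step t y u (hAt1 t ht) (hty.trans hy) hty hu2 hy hud
    obtain ⟨r, hr1, hr2, hr3, hr4⟩ := step s z u (hAt1 s hs) (hsz.trans hz) hsz hu3 hz hud
    have hu : u ≠ 1 := by
      rintro rfl
      exact hAt1 t ht (hu2.antisymm (F.one_le _))
    obtain ⟨w, hw1, hw2, hw3, hw4⟩ := step u p r hu hud hp3 hr3 hp1 hr1
    refine ⟨w, hw1, hp2.trans hw2, hr2.trans hw3, ?_⟩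
    intro a had hya hza
    have hua : F.le u a := hu4 a (had.trans hdc) (hty.trans hya) (hsz.trans hza)
    exact hw4 a had (hp4 a had hya hua) (hr4 a had hza hua)

/-- The L-algebra on an interval which is a lattice. -/
noncomputable def interval (F : LenFn W) (c : W)
    (H : ∀ y z, F.le y c → F.le z c → ∃ w, F.IsJoin c y z w) : LAlg {a : W // F.le a c} :=
  let J : ∀ y z : {a : W // F.le a c}, W := fun y z => (H y z y.2 z.2).choose
  have hJ : ∀ y z : {a : W // F.le a c}, F.IsJoin c y z (J y z) :=
    fun y z => (H y z y.2 z.2).choose_spec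
  have uniq : ∀ (y z : {a : W // F.le a c}) w, F.IsJoin c y z w → J y z = w := by
    intro y z w hw
    obtain ⟨h1, h2, h3, h4⟩ := hw
    obtain ⟨g1, g2, g3, g4⟩ := hJ y z
    exact le.antisymm (g4 w h1 h2 h3) (h4 _ g1 g2 g3)
  { e := ⟨1, F.one_le c⟩
    cmp := fun a b => ⟨a.1⁻¹ * J a b, (hJ a b).2.1.sub (hJ a b).1⟩
    e_cmp := by
      intro a
      apply Subtype.ext
      simpa using uniq ⟨1, F.one_le c⟩ a a.1 ⟨a.2, F.one_le _, F.le_refl _, fun _ _ _ h => h⟩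
    cmp_e := by
      intro a
      apply Subtype.ext
      have := uniq a ⟨1, F.one_le c⟩ a.1 ⟨a.2, F.le_refl _, F.one_le _, fun _ _ h _ => h⟩
      simp [this]
    cmp_self := by
      intro a
      apply Subtype.ext
      have := uniq a a a.1 ⟨a.2, F.le_refl _, F.le_refl _, fun _ _ h _ => h⟩
      simp [this]
    cube := by
      have key : ∀ a b d : {a : W // F.le a c}, J ⟨a.1⁻¹ * J a b, (hJ a b).2.1.sub (hJ a b).1⟩
          ⟨a.1⁻¹ * J a d, (hJ a d).2.1.sub (hJ a d).1⟩ =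
          a.1⁻¹ * J ⟨J a b, (hJ a b).1⟩ ⟨J a d, (hJ a d).1⟩ := by
        intro a b d
        obtain ⟨p1, p2, p3, p4⟩ := hJ a b
        obtain ⟨r1, r2, r3, r4⟩ := hJ a d
        obtain ⟨g1, g2, g3, g4⟩ := hJ ⟨J a b, p1⟩ ⟨J a d, r1⟩
        obtain ⟨k1, k2, k3, k4⟩ := hJ ⟨a.1⁻¹ * J a b, p2.sub p1⟩ ⟨a.1⁻¹ * J a d, r2.sub r1⟩
        have haJ := p2.trans g2
        have hK := k4 _ (haJ.sub g1) ((p2.translate haJ).2 g2) ((r2.translate haJ).2 g3)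
        obtain ⟨m1, m2⟩ := haJ.mul_left hK
        have hle := g4 _ (m2.trans g1) (by rw [← p2.translate m1]; simpa using k2)
          (by rw [← r2.translate m1]; simpa using k3)
        rw [eq_inv_mul_iff_mul_eq]
        exact m2.antisymm hle
      intro a b d
      apply Subtype.ext
      show (a.1⁻¹ * J a b)⁻¹ * _ = (b.1⁻¹ * J b a)⁻¹ * _
      rw [key a b d, key b a d]
      have hs : J b a = J a b := by
        obtain ⟨p1, p2, p3, p4⟩ := hJ a b
        exact uniq b a _ ⟨p1, p3, p2, fun x h1 h2 h3 => p4 x h1 h3 h2⟩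
      have h3 : J ⟨J a b, (hJ a b).1⟩ ⟨J a d, (hJ a d).1⟩ =
          J ⟨J b a, (hJ b a).1⟩ ⟨J b d, (hJ b d).1⟩ := by
        obtain ⟨g1, g2, g3, g4⟩ := hJ ⟨J a b, (hJ a b).1⟩ ⟨J a d, (hJ a d).1⟩
        symm
        apply uniq
        refine ⟨g1, ?_, ?_, ?_⟩
        · show F.le (J b a) _
          rw [hs]; exact g2
        · exact (hJ b d).2.2.2 _ g1 ((hJ a b).2.2.1.trans g2) ((hJ a d).2.2.1.trans g3)
        · intro x hx h1 h2
          have hax : F.le a.1 x := (hJ b a).2.2.1.trans h1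
          have hbx : F.le b.1 x := (hJ b a).2.1.trans h1
          have hdx : F.le d.1 x := (hJ b d).2.2.1.trans h2
          exact g4 x hx ((hJ a b).2.2.2 x hx hax hbx) ((hJ a d).2.2.2 x hx hax hdx)
      rw [h3]
      generalize J ⟨J b a, (hJ b a).1⟩ ⟨J b d, (hJ b d).1⟩ = X
      rw [hs]
      group }

variable (H : ∀ y z, F.le y c → F.le z c → ∃ w, F.IsJoin c y z w)

theorem interval_cmp (a b : {a : W // F.le a c}) : ∃ J, F.IsJoin c a b J ∧
    (((F.interval c H).cmp a b : {a : W // F.le a c}) : W) = a.1⁻¹ * J ∧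
    (((F.interval c H).cmp b a : {a : W // F.le a c}) : W) = b.1⁻¹ * J := by
  have h1 := (H a b a.2 b.2).choose_spec
  have h2 := (H b a b.2 a.2).choose_spec
  have h3 : (H a b a.2 b.2).choose = (H b a b.2 a.2).choose :=
    le.antisymm (h1.2.2.2 _ h2.1 h2.2.2.1 h2.2.1) (h2.2.2.2 _ h1.1 h1.2.2.1 h1.2.1)
  refine ⟨(H a b a.2 b.2).choose, h1, rfl, ?_⟩
  rw [h3]; rfl

theorem interval_e : ((F.interval c H).e : W) = 1 := rfl

theorem interval_len (a b : {a : W // F.le a c}) :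
    F.l a + F.l ((F.interval c H).cmp a b) = F.l b + F.l ((F.interval c H).cmp b a) := by
  obtain ⟨J, ⟨h1, h2, h3, h4⟩, h5, h6⟩ := interval_cmp H a b
  rw [h5, h6]
  unfold le at h2 h3
  omega

theorem interval_cmp_top (a : {a : W // F.le a c}) :
    (((F.interval c H).cmp a ⟨c, F.le_refl c⟩ : {a : W // F.le a c}) : W) = a.1⁻¹ * c := by
  obtain ⟨J, ⟨h1, h2, h3, h4⟩, h5, h6⟩ := interval_cmp H a ⟨c, F.le_refl c⟩
  rw [h5, h1.antisymm h3]

theorem interval_top {N : ℕ} (hN : c ^ N = 1) : (F.interval c H).Top ⟨c, F.le_refl c⟩ N := by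
  constructor
  · intro a
    obtain ⟨J, ⟨h1, h2, h3, h4⟩, h5, h6⟩ := interval_cmp H a ⟨c, F.le_refl c⟩
    apply Subtype.ext
    rw [h6, h1.antisymm h3, interval_e]
    simp
  · intro a
    have : ∀ k, ((fun a => (F.interval c H).cmp ((F.interval c H).cmp a ⟨c, F.le_refl c⟩)
        ⟨c, F.le_refl c⟩)^[k] a : {a : W // F.le a c}) = (c ^ k)⁻¹ * a.1 * c ^ k := by
      intro k
      induction k with
      | zero => simp
      | succ k ih =>
        rw [Function.iterate_succ_apply', interval_cmp_top, interval_cmp_top, ih]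
        group
    apply Subtype.ext
    rw [this, hN]; simp

end LenFn

open Equiv

namespace NC

variable {n : ℕ}

/-- Functions constant along the orbits of `a`. -/
def Fix (a : Perm (Fin n)) : Submodule ℚ (Fin n → ℚ) where
  carrier := {v | ∀ x, v (a x) = v x}
  add_mem' := by
    intro v w hv hw x
    simp [hv x, hw x]
  zero_mem' := fun x => rfl
  smul_mem' := by
    intro c v hv x
    simp [hv x]

theorem mem_Fix {a : Perm (Fin n)} {v : Fin n → ℚ} : v ∈ Fix a ↔ ∀ x, v (a x) = v x := Iff.rfl

/-- rank -/
noncomputable def rk (a : Perm (Fin n)) : ℕ := Module.finrank ℚ (Fix a)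

theorem rk_le (a : Perm (Fin n)) : rk a ≤ n := by
  have := Submodule.finrank_le (Fix a)
  rw [Module.finrank_fin_fun] at this
  exact this

theorem rk_one : rk (1 : Perm (Fin n)) = n := by
  have : Fix (1 : Perm (Fin n)) = ⊤ := by
    rw [eq_top_iff]; intro v _ x; rfl
  rw [rk, this]; simp

theorem inf_le_mul (a b : Perm (Fin n)) : Fix a ⊓ Fix b ≤ Fix (a * b) := by
  rintro v ⟨h1, h2⟩ x
  rw [Perm.mul_apply, h1, h2]

/-- The absolute length. -/
noncomputable def len : LenFn (Perm (Fin n)) where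
  l a := n - rk a
  l_one := by simp [rk_one]
  eq_one := by
    intro a ha
    have h1 : rk a = n := by have := rk_le a; omega
    have h2 : Fix a = ⊤ := by
      apply Submodule.eq_top_of_finrank_eq
      rw [← rk, h1]; simp
    ext x : 1
    have h3 : Pi.single x (1 : ℚ) ∈ Fix a := by rw [h2]; trivial
    have h4 := h3 x
    by_contra h5
    rw [Pi.single_eq_of_ne (by simpa using h5)] at h4
    simp at h4
  mul_le := by
    intro a b
    have h1 := Submodule.finrank_sup_add_finrank_inf_eq (Fix a) (Fix b)
    have h2 := Submodule.finrank_le (Fix a ⊔ Fix b)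
    have h3 := Submodule.finrank_mono (inf_le_mul a b)
    rw [Module.finrank_fin_fun] at h2
    have h4 := rk_le a
    have h5 := rk_le b
    have h6 := rk_le (a * b)
    unfold rk at *
    omega
  conj := by
    intro g a
    congr 1
    have : Fix a = (Fix (g * a * g⁻¹)).map (LinearEquiv.funCongrLeft ℚ ℚ g).toLinearMap := by
      ext v
      simp only [Submodule.mem_map]
      constructor
      · intro hv
        refine ⟨fun x => v (g⁻¹ x), ?_, ?_⟩
        · intro x
          have := hv (g⁻¹ x)
          simpa using this
        · ext x
          simp [LinearEquiv.funCongrLeft]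
      · rintro ⟨w, hw, rfl⟩ x
        have := hw (g x)
        simpa [LinearEquiv.funCongrLeft] using this
    unfold rk
    rw [this]
    exact (LinearEquiv.finrank_map_eq _ _).symm

theorem len_l (a : Perm (Fin n)) : len.l a = n - rk a := rfl

theorem Fix_anti {a b : Perm (Fin n)} (h : len.le a b) : Fix b ≤ Fix a := by
  have h0 := inf_le_mul a (a⁻¹ * b)
  rw [mul_inv_cancel_left] at h0
  have h1 := Submodule.finrank_sup_add_finrank_inf_eq (Fix a) (Fix (a⁻¹ * b))
  have h2 := Submodule.finrank_le (Fix a ⊔ Fix (a⁻¹ * b))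
  rw [Module.finrank_fin_fun] at h2
  unfold LenFn.le at h
  rw [len_l, len_l, len_l] at h
  have h4 := rk_le a
  have h5 := rk_le b
  have h6 := rk_le (a⁻¹ * b)
  unfold rk at *
  have h7 := Submodule.eq_of_le_of_finrank_le h0 (by omega)
  rw [← h7]; exact inf_le_left

/-- `x` and `y` lie in the same orbit. -/
def sim (a : Perm (Fin n)) (x y : Fin n) : Prop := ∀ v ∈ Fix a, v x = v y

theorem sim.symm {a : Perm (Fin n)} {x y : Fin n} (h : sim a x y) : sim a y x :=
  fun v hv => (h v hv).symm

theorem sim.trans {a : Perm (Fin n)} {x y z : Fin n} (h : sim a x y) (h' : sim a y z) : sim a x z :=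
  fun v hv => (h v hv).trans (h' v hv)

theorem sim.mono {a b : Perm (Fin n)} (hab : len.le a b) {x y : Fin n} (h : sim a x y) :
    sim b x y := fun v hv => h v (Fix_anti hab hv)

theorem sim_apply (a : Perm (Fin n)) (x : Fin n) : sim a x (a x) := fun _ hv => (hv x).symm

theorem Fix_swap {i j : Fin n} {v : Fin n → ℚ} : v ∈ Fix (swap i j) ↔ v i = v j := by
  constructor
  · intro h
    have := h j
    simpa using this
  · intro h x
    rcases eq_or_ne x i with rfl | hi
    · simp [h]
    rcases eq_or_ne x j with rfl | hj
    · simp [h]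
    rw [swap_apply_of_ne_of_ne hi hj]

theorem len_swap {i j : Fin n} (hij : i ≠ j) : len.l (swap i j) = 1 := by
  let f : (Fin n → ℚ) →ₗ[ℚ] ℚ :=
    (LinearMap.proj i : (Fin n → ℚ) →ₗ[ℚ] ℚ) - LinearMap.proj j
  have h1 : Fix (swap i j) = LinearMap.ker f := by
    ext v
    rw [Fix_swap, LinearMap.mem_ker]
    simp [f, sub_eq_zero]
  have h2 : LinearMap.range f = ⊤ := by
    rw [LinearMap.range_eq_top]
    intro q
    refine ⟨Pi.single i q, ?_⟩
    simp [f, Pi.single_eq_of_ne hij.symm]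
  have h3 := LinearMap.finrank_range_add_finrank_ker f
  rw [h2, finrank_top, Module.finrank_self, Module.finrank_fin_fun] at h3
  rw [len_l, rk, h1]
  omega

theorem Fix_le_swap_mul {a : Perm (Fin n)} {i j : Fin n} (h : sim a i j) :
    Fix a ≤ Fix (swap i j * a) := by
  intro v hv x
  rw [Perm.mul_apply, Fix_swap.2 (h v hv), hv]

theorem swap_le_of_mem {a : Perm (Fin n)} {i j : Fin n} (hij : i ≠ j) (h : sim a i j)
    {v : Fin n → ℚ} (hv : v ∈ Fix (swap i j * a)) (hv' : v ∉ Fix a) : len.le (swap i j) a := by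
  have h1 : Fix a < Fix (swap i j * a) :=
    lt_of_le_of_ne (Fix_le_swap_mul h) (fun h => hv' (h ▸ hv))
  have h2 := Submodule.finrank_lt_finrank_of_lt h1
  have h3 := len.mul_le (swap i j) (swap i j * a)
  rw [swap_mul_self_mul] at h3
  unfold LenFn.le
  rw [swap_inv]
  have h4 := len_swap hij
  rw [h4] at h3 ⊢
  have h5 := rk_le (swap i j * a)
  rw [len_l, len_l] at *
  unfold rk at *
  omega

theorem sim_of_swap_le {a : Perm (Fin n)} {i j : Fin n} (h : len.le (swap i j) a) : sim a i j :=
  fun _ hv => Fix_swap.1 (Fix_anti h hv)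

/-- indicator function -/
noncomputable def ind (P : Set (Fin n)) : Fin n → ℚ :=
  open Classical in fun x => if x ∈ P then 1 else 0

theorem ind_eq {P : Set (Fin n)} {x y : Fin n} : ind P x = ind P y ↔ (x ∈ P ↔ y ∈ P) := by
  unfold ind
  by_cases h1 : x ∈ P <;> by_cases h2 : y ∈ P <;> simp [h1, h2]

theorem ind_mem_of_inv {a : Perm (Fin n)} {P : Set (Fin n)} (h : ∀ x ∈ P, a x ∈ P) :
    ind P ∈ Fix a := by
  intro x
  rw [ind_eq]
  refine ⟨fun hx => ?_, h x⟩
  have hsurj : Set.SurjOn a P P := by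
    have h1 : Set.MapsTo a P P := h
    have := Set.toFinite P
    have h3 : a '' P = P := Set.eq_of_subset_of_ncard_le h1.image_subset
      (by rw [Set.ncard_image_of_injective _ a.injective]) this
    rw [Set.SurjOn, h3]
  obtain ⟨y, hy, hyx⟩ := hsurj hx
  rwa [← a.injective hyx]

theorem exists_atom (a : Perm (Fin n)) (ha : a ≠ 1) :
    ∃ i j, i < j ∧ len.le (swap i j) a := by
  obtain ⟨x, hx⟩ : ∃ x, a x ≠ x := by
    by_contra! h
    exact ha (Perm.ext h)
  have key : len.le (swap x (a x)) a := by
    refine swap_le_of_mem hx.symm (sim_apply a x) (v := ind {x}) (ind_mem_of_inv ?_) ?_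
    · rintro y rfl
      simp
    · intro h
      have := h x
      rw [ind_eq] at this
      simp [hx] at this
  rcases lt_or_gt_of_ne hx with h | h
  · exact ⟨_, _, h, by rwa [swap_comm]⟩
  · exact ⟨_, _, h, key⟩

/-- Order property of noncrossing permutations. -/
def Q (a : Perm (Fin n)) : Prop :=
  ∀ i j, i < j → sim a i j → ∀ x, i ≤ x → x < j → i < a x ∧ a x ≤ j

variable {a : Perm (Fin n)} {i j k l : Fin n}

theorem Q.inv (h : Q a) (hij : i < j) (hs : sim a i j) :
    ind (Set.Ico i j) ∈ Fix (swap i j * a) := by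
  apply ind_mem_of_inv
  rintro x ⟨h1, h2⟩
  obtain ⟨h3, h4⟩ := h i j hij hs x h1 h2
  rw [Perm.mul_apply]
  rcases eq_or_ne (a x) j with h5 | h5
  · rw [h5, swap_apply_right]; exact ⟨le_rfl, hij⟩
  · rw [swap_apply_of_ne_of_ne h3.ne' h5]
    exact ⟨h3.le, lt_of_le_of_ne h4 h5⟩

theorem Q.swap_le (h : Q a) (hij : i < j) (hs : sim a i j) : len.le (swap i j) a := by
  refine swap_le_of_mem hij.ne hs (h.inv hij hs) ?_
  intro h1
  have := hs _ h1
  rw [ind_eq] at this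
  simp [hij] at this

theorem Q.swap_le_iff (h : Q a) (hij : i < j) : len.le (swap i j) a ↔ sim a i j :=
  ⟨sim_of_swap_le, h.swap_le hij⟩

theorem Q.swap_mul (h : Q a) (hij : i < j) (hs : sim a i j) : Q (swap i j * a) := by
  intro k l hkl hkl' x hkx hxl
  have h1 := hkl' _ (h.inv hij hs)
  rw [ind_eq] at h1
  simp only [Set.mem_Ico] at h1
  obtain ⟨h2, h3⟩ := h k l hkl (fun v hv => hkl' v (Fix_le_swap_mul hs hv)) x hkx hxl
  rw [Perm.mul_apply]
  rcases eq_or_ne (a x) i with h5 | h5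
  · rw [h5, swap_apply_left]
    rw [h5] at h2 h3
    refine ⟨h2.trans hij, ?_⟩
    by_contra! h6
    exact absurd (h1.2 ⟨h3, h6⟩).1 (not_le.2 h2)
  rcases eq_or_ne (a x) j with h6 | h6
  · rw [h6, swap_apply_right]
    rw [h6] at h2 h3
    refine ⟨?_, hij.le.trans h3⟩
    by_contra! h7
    exact absurd (h1.1 ⟨h7, h2⟩).2 (not_lt.2 h3)
  rw [swap_apply_of_ne_of_ne h5 h6]
  exact ⟨h2, h3⟩

theorem Q.sim_swap_mul (h : Q a) (hij : i < j) (hs : sim a i j) {x y : Fin n} :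
    sim (swap i j * a) x y ↔ sim a x y ∧ (x ∈ Set.Ico i j ↔ y ∈ Set.Ico i j) := by
  constructor
  · intro hxy
    exact ⟨fun v hv => hxy v (Fix_le_swap_mul hs hv), ind_eq.1 (hxy _ (h.inv hij hs))⟩
  · rintro ⟨h1, h2⟩
    have hle : Fix a ⊔ Submodule.span ℚ {ind (Set.Ico i j)} ≤ Fix (swap i j * a) := by
      apply sup_le (Fix_le_swap_mul hs)
      rw [Submodule.span_singleton_le_iff_mem]
      exact h.inv hij hs
    have hnot : ind (Set.Ico i j) ∉ Fix a := by
      intro h1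
      have := hs _ h1
      rw [ind_eq] at this
      simp [hij] at this
    have hlt : Fix a < Fix a ⊔ Submodule.span ℚ {ind (Set.Ico i j)} := by
      apply lt_of_le_of_ne le_sup_left
      intro h3
      apply hnot
      rw [h3]
      exact Submodule.mem_sup_right (Submodule.mem_span_singleton_self _)
    have h4 := Submodule.finrank_lt_finrank_of_lt hlt
    have h5 := h.swap_le hij hs
    unfold LenFn.le at h5
    rw [swap_inv, len_swap hij.ne, len_l, len_l] at h5
    have h6 := rk_le a
    have h7 := rk_le (swap i j * a)
    unfold rk at *
    have h8 := Submodule.eq_of_le_of_finrank_le hle (by omega)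
    intro v hv
    rw [← h8, Submodule.mem_sup] at hv
    obtain ⟨u, hu, w, hw, rfl⟩ := hv
    rw [Submodule.mem_span_singleton] at hw
    obtain ⟨q, rfl⟩ := hw
    simp only [Pi.add_apply, Pi.smul_apply]
    rw [h1 u hu, ind_eq.2 h2]

theorem Q_of_le {c : Perm (Fin n)} (hc : Q c) (N : ℕ) :
    ∀ a, len.le a c → len.l (a⁻¹ * c) ≤ N → Q a := by
  induction N with
  | zero =>
    intro a ha h0
    have := len.eq_one _ (Nat.le_zero.1 h0)
    rw [inv_mul_eq_one] at this
    rwa [this]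
  | succ N ih =>
    intro a ha hN
    by_cases hb : c * a⁻¹ = 1
    · rw [mul_inv_eq_one] at hb; rwa [← hb]
    obtain ⟨i, j, hij, hle⟩ := exists_atom _ hb
    unfold LenFn.le at ha hle
    rw [swap_inv, len_swap hij.ne] at hle
    have e1 : len.l (c * a⁻¹) = len.l (a⁻¹ * c) := by
      rw [← len.conj a (a⁻¹ * c)]; congr 1; group
    have e2 : len.l ((swap i j * a)⁻¹ * c) = len.l (swap i j * (c * a⁻¹)) := by
      rw [← len.conj (swap i j * a) ((swap i j * a)⁻¹ * c), ← len.conj (swap i j) (swap i j * _)]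
      congr 1
      rw [mul_inv_rev, swap_inv, swap_mul_self_mul]
      simp only [mul_assoc]
      simp
    have h1 := len.mul_le (swap i j) a
    have h2 := len.mul_le (swap i j * a) ((swap i j * a)⁻¹ * c)
    rw [mul_inv_cancel_left] at h2
    rw [len_swap hij.ne] at h1
    have h3 : len.le (swap i j * a) c := by unfold LenFn.le; omega
    have h4 := ih _ h3 (by omega)
    have h5 : len.le (swap i j) (swap i j * a) := by
      unfold LenFn.le
      rw [swap_inv, swap_mul_self_mul, len_swap hij.ne]; omega
    have := h4.swap_mul hij (sim_of_swap_le h5)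
    rwa [swap_mul_self_mul] at this

end NC

open Equiv

theorem LenFn.le_suffix {W : Type*} [Group W] {F : LenFn W} {x y : W} (h : F.le x (x * y)) :
    F.le y (x * y) := by
  unfold LenFn.le at *
  have e : y⁻¹ * (x * y) = y⁻¹ * x * y⁻¹⁻¹ := by group
  rw [e, F.conj]
  rw [inv_mul_cancel_left] at h
  omega

namespace NC

variable {n : ℕ} {a c : Perm (Fin n)} {i j k l : Fin n}

theorem pair_cases (hij : i < j) (hkl : k < l) :
    (k ∈ Set.Ico i j ↔ l ∈ Set.Ico i j) ∨ (i ∈ Set.Ico k l ↔ j ∈ Set.Ico k l) ∨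
    (i = k ∧ j = l) ∨ (i < k ∧ k < j ∧ j < l) ∨ (k < i ∧ i < l ∧ l < j) := by
  simp only [Set.mem_Ico, Fin.lt_def, Fin.le_def, Fin.ext_iff] at *
  omega

theorem same_le (h : Q a) (hij : i < j) (hkl : k < l) (h1 : sim a i j) (h2 : sim a k l)
    (hs : k ∈ Set.Ico i j ↔ l ∈ Set.Ico i j) :
    len.le (swap i j * swap k l) a ∧ len.le (swap i j) (swap i j * swap k l) ∧
    len.le (swap k l) (swap i j * swap k l) := by
  have h3 := h.swap_le hij h1
  have h4 := h.swap_mul hij h1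
  have h5 := h4.swap_le hkl ((h.sim_swap_mul hij h1).2 ⟨h2, hs⟩)
  have h6 := h3.mul_left (by rw [swap_inv]; exact h5)
  exact ⟨h6.2, h6.1, LenFn.le_suffix h6.1⟩

theorem cross_sim (h : Q a) (hik : i < k) (hkj : k < j) (hjl : j < l) (h1 : sim a i j)
    (h2 : sim a k l) : sim a i k := by
  intro v hv
  by_contra hne
  have key : ∀ x, i ≤ x → x < k → i < a x ∧ a x ≤ k := by
    intro x hx1 hx2
    obtain ⟨h3, h4⟩ := h i j (hik.trans hkj) h1 x hx1 (hx2.trans hkj)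
    refine ⟨h3, ?_⟩
    by_contra! h5
    have hmap : a '' (Set.Ico k l) = Set.Ioc k l := by
      apply Set.eq_of_subset_of_ncard_le
      · rintro _ ⟨y, ⟨hy1, hy2⟩, rfl⟩
        exact h k l (hkj.trans hjl) h2 y hy1 hy2
      · rw [Set.ncard_image_of_injective _ a.injective, ← Finset.coe_Ico, ← Finset.coe_Ioc,
          Set.ncard_coe_finset, Set.ncard_coe_finset]
        simp
      · exact Set.toFinite _
    have : a x ∈ a '' (Set.Ico k l) := by
      rw [hmap]; exact ⟨h5, h4.trans hjl.le⟩
    obtain ⟨y, hy, hyx⟩ := this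
    rw [a.injective hyx] at hy
    exact absurd hy.1 (not_le.2 hx2)
  have hO : ind {x | (i ≤ x ∧ x < k) ∧ v x = v i} ∈ Fix a := by
    apply ind_mem_of_inv
    rintro x ⟨⟨hx1, hx2⟩, hx3⟩
    obtain ⟨h3, h4⟩ := key x hx1 hx2
    have h5 : v (a x) = v i := by rw [hv, hx3]
    refine ⟨⟨h3.le, lt_of_le_of_ne h4 ?_⟩, h5⟩
    intro h6
    rw [h6] at h5
    exact hne h5.symm
  have := h1 _ hO
  rw [ind_eq] at this
  simp only [Set.mem_ofPred_eq, le_refl, true_and, and_true, hik, true_iff] at this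
  exact absurd this.1.2 (not_lt.2 hkj.le)

theorem cross_le (h : Q a) (hik : i < k) (hkj : k < j) (hjl : j < l) (h1 : sim a i j)
    (h2 : sim a k l) :
    len.le (swap i k * (swap k j * swap j l)) a ∧
    sim (swap i k * (swap k j * swap j l)) i j ∧ sim (swap i k * (swap k j * swap j l)) k l := by
  have hi := cross_sim h hik hkj hjl h1 h2
  have hkjs : sim a k j := hi.symm.trans h1
  have hjls : sim a j l := hkjs.symm.trans h2
  have q1 := h.swap_mul hik hi
  have s1 : sim (swap i k * a) k j := (h.sim_swap_mul hik hi).2 ⟨hkjs, by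
    simp only [Set.mem_Ico, Fin.lt_def, Fin.le_def] at *; omega⟩
  have s2 : sim (swap i k * a) j l := (h.sim_swap_mul hik hi).2 ⟨hjls, by
    simp only [Set.mem_Ico, Fin.lt_def, Fin.le_def] at *; omega⟩
  obtain ⟨g1, g2, g3⟩ := same_le q1 hkj hjl s1 s2
    (by simp only [Set.mem_Ico, Fin.lt_def, Fin.le_def] at *; omega)
  obtain ⟨f1, f2⟩ := (h.swap_le hik hi).mul_left (by rw [swap_inv]; exact g1)
  have f3 := LenFn.le_suffix f1
  have t1 := sim_of_swap_le f1
  have t2 := sim_of_swap_le (g2.trans f3)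
  have t3 := sim_of_swap_le (g3.trans f3)
  exact ⟨f2, t1.trans t2, t2.trans t3⟩

theorem exists_joins (hc : Q c) (y z : Perm (Fin n)) (hy : len.le y c) (hz : len.le z c) :
    ∃ w, len.IsJoin c y z w := by
  refine LenFn.exists_join (F := len) (c := c) (fun t => ∃ i j, i < j ∧ t = swap i j) ?_ ?_ ?_
    (len.l c) c (LenFn.le_refl _ _) le_rfl y z hy hz
  · rintro _ ⟨i, j, hij, rfl⟩ h
    exact hij.ne (swap_eq_one_iff.1 h)
  · intro a _ ha
    obtain ⟨i, j, hij, h⟩ := exists_atom a ha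
    exact ⟨_, ⟨i, j, hij, rfl⟩, h⟩
  · have hQ : ∀ a, len.le a c → Q a := fun a ha => Q_of_le hc _ a ha le_rfl
    have same : ∀ i j k l : Fin n, i < j → k < l → len.le (swap i j) c → len.le (swap k l) c →
        (k ∈ Set.Ico i j ↔ l ∈ Set.Ico i j) → ∃ u, len.IsJoin c (swap i j) (swap k l) u := by
      intro i j k l hij hkl h1 h2 hs
      obtain ⟨g1, g2, g3⟩ := same_le hc hij hkl (sim_of_swap_le h1) (sim_of_swap_le h2) hs
      refine ⟨_, g1, g2, g3, ?_⟩
      intro a ha h3 h4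
      exact (same_le (hQ a ha) hij hkl (sim_of_swap_le h3) (sim_of_swap_le h4) hs).1
    have cross : ∀ i j k l : Fin n, i < k → k < j → j < l → len.le (swap i j) c →
        len.le (swap k l) c → ∃ u, len.IsJoin c (swap i j) (swap k l) u := by
      intro i j k l hik hkj hjl h1 h2
      obtain ⟨g1, g2, g3⟩ := cross_le hc hik hkj hjl (sim_of_swap_le h1) (sim_of_swap_le h2)
      refine ⟨_, g1, (hQ _ g1).swap_le (hik.trans hkj) g2, (hQ _ g1).swap_le (hkj.trans hjl) g3, ?_⟩
      intro a ha h3 h4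
      exact (cross_le (hQ a ha) hik hkj hjl (sim_of_swap_le h3) (sim_of_swap_le h4)).1
    have sym : ∀ t s : Perm (Fin n), (∃ u, len.IsJoin c t s u) → ∃ u, len.IsJoin c s t u := by
      rintro t s ⟨u, h1, h2, h3, h4⟩
      exact ⟨u, h1, h3, h2, fun a ha h5 h6 => h4 a ha h6 h5⟩
    rintro _ _ ⟨i, j, hij, rfl⟩ ⟨k, l, hkl, rfl⟩ h1 h2
    rcases pair_cases hij hkl with h | h | ⟨rfl, rfl⟩ | ⟨h3, h4, h5⟩ | ⟨h3, h4, h5⟩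
    · exact same _ _ _ _ hij hkl h1 h2 h
    · exact sym _ _ (same _ _ _ _ hkl hij h2 h1 h)
    · exact ⟨_, h1, LenFn.le_refl _ _, LenFn.le_refl _ _, fun a _ h _ => h⟩
    · exact cross _ _ _ _ h3 h4 h5 h1 h2
    · exact sym _ _ (cross _ _ _ _ h3 h4 h5 h2 h1)

theorem Q_rot (m : ℕ) : Q (finRotate (m + 1)) := by
  intro i j hij _ x hix hxj
  rw [finRotate_apply]
  have h1 : (x + 1 : Fin (m + 1)).val = x.val + 1 := by
    rw [Fin.val_add_one_of_lt]
    exact lt_of_lt_of_le hxj (Fin.le_last j)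
  simp only [Fin.lt_def, Fin.le_def, h1] at *
  omega

theorem rot_pow (m : ℕ) : (finRotate (m + 1)) ^ (m + 1) = 1 := by
  have : ∀ (k : ℕ) x, (((finRotate (m + 1)) ^ k) x).val = (x.val + k) % (m + 1) := by
    intro k
    induction k with
    | zero => intro x; simp [Nat.mod_eq_of_lt x.2]
    | succ k ih =>
      intro x
      rw [pow_succ', Perm.mul_apply, finRotate_apply, Fin.val_add, ih, Fin.val_one', ← Nat.add_mod,
        add_assoc]
  ext1 x
  apply Fin.ext
  rw [this]
  simp [Nat.mod_eq_of_lt x.2]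

/-- The noncrossing permutations -/
abbrev S (m : ℕ) := {a : Perm (Fin (m + 1)) // len.le a (finRotate (m + 1))}

/-- The dual Garside structure -/
noncomputable def alg (m : ℕ) : LAlg (S m) :=
  len.interval (finRotate (m + 1)) (exists_joins (Q_rot m))

/-- top -/
def top (m : ℕ) : S m := ⟨finRotate (m + 1), LenFn.le_refl _ _⟩

theorem alg_top (m : ℕ) : (alg m).Top (top m) (m + 1) :=
  LenFn.interval_top _ (rot_pow m)

theorem alg_no_units (m : ℕ) (x y : (alg m).Mon) (h : x * y = 1) : x = 1 := by
  refine (alg m).no_units (fun a => len.l a.1) ?_ ?_ ?_ x y h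
  · intro a ha
    exact Subtype.ext (len.eq_one _ ha)
  · exact len.l_one
  · exact LenFn.interval_len _

theorem S_Q {m : ℕ} {a : Perm (Fin (m + 1))} (ha : len.le a (finRotate (m + 1))) : Q a :=
  Q_of_le (Q_rot m) _ a ha le_rfl

end NC

namespace BrSeq

variable {G : Type*} [Group G] {N : ℕ} {s : ℕ → G}

/-- BKL atoms -/
def at' (s : ℕ → G) (i j : ℕ) : G := (dd s j)⁻¹ * (dd s i * s i * (dd s i)⁻¹) * dd s j

theorem at_self (s : ℕ → G) (i : ℕ) : at' s i (i + 1) = s i := by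
  simp only [at', dd]; group

theorem at_succ (s : ℕ → G) (i j : ℕ) : at' s i (j + 1) = (s j)⁻¹ * at' s i j * s j := by
  simp only [at', dd]; group

theorem at_comm_gt (h : BrSeq N s) {i j p : ℕ} (hij : i < j) (hjp : j < p) (hp : p < N) :
    Commute (s p) (at' s i j) := by
  have e : ∀ k, k < p → Commute (s p) (dd s k) := fun k hk => (h.dd_comm hk hp).symm
  have e2 : Commute (s p) (s i) := (h.comm i p (by omega) hp).symm
  unfold at'
  exact ((e j hjp).inv_right.mul_right (((e i (by omega)).mul_right e2).mul_right
    (e i (by omega)).inv_right)).mul_right (e j hjp)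

theorem at_comm_in (h : BrSeq N s) {i j p : ℕ} (hip : i < p) (hjp : p + 1 < j) (hj : j ≤ N) :
    Commute (s p) (at' s i j) := by
  have e : ∀ k, k < p + 1 → Commute (s (p+1)) (dd s k) :=
    fun k hk => (h.dd_comm hk (by omega)).symm
  have e2 : Commute (s (p+1)) (s i) := (h.comm i (p+1) (by omega) (by omega)).symm
  have e3 : s p = (dd s j)⁻¹ * s (p+1) * dd s j := by
    rw [mul_assoc, ← h.dd_shift hjp hj]; group
  have e4 : Commute (s (p+1)) (dd s i * s i * (dd s i)⁻¹) :=
    (((e i (by omega)).mul_right e2).mul_right (e i (by omega)).inv_right)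
  rw [e3, at']
  have := e4.eq
  unfold Commute SemiconjBy
  generalize dd s i * s i * (dd s i)⁻¹ = x at *
  calc _ = (dd s j)⁻¹ * (s (p+1) * x) * dd s j := by group
    _ = _ := by rw [this]; group

/-- elements commuting with all letters in [k, l) -/
theorem comm_D {x : G} {k l : ℕ} (hkl : k ≤ l) (h : ∀ p, k ≤ p → p < l → Commute (s p) x) :
    Commute ((dd s k)⁻¹ * dd s l) x := by
  induction l, hkl using Nat.le_induction with
  | base => rw [inv_mul_cancel]; exact Commute.one_left _
  | succ l hl ih =>
    rw [dd, ← mul_assoc]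
    exact (ih fun p h1 h2 => h p h1 (by omega)).mul_left (h l hl (by omega))

theorem at_eq (s : ℕ → G) (k l : ℕ) :
    at' s k l = ((dd s k)⁻¹ * dd s l)⁻¹ * s k * ((dd s k)⁻¹ * dd s l) := by
  unfold at'; group

theorem comm_at {x : G} {k l : ℕ} (hkl : k < l) (h : ∀ p, k ≤ p → p < l → Commute (s p) x) :
    Commute (at' s k l) x := by
  rw [at_eq]
  have := comm_D hkl.le h
  exact (this.inv_left.mul_left (h k le_rfl hkl)).mul_left this

theorem at_disj (h : BrSeq N s) {i j k l : ℕ} (hij : i < j) (hjk : j < k) (hkl : k < l) (hl : l ≤ N) :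
    Commute (at' s k l) (at' s i j) :=
  comm_at hkl fun _ h1 h2 => h.at_comm_gt hij (by omega) (by omega)

theorem at_nest (h : BrSeq N s) {i j k l : ℕ} (hik : i < k) (hkl : k < l) (hlj : l < j) (hl : j ≤ N) :
    Commute (at' s k l) (at' s i j) :=
  comm_at hkl fun _ h1 h2 => h.at_comm_in (by omega) (by omega) (by omega)

theorem at_braid (h : BrSeq N s) {i j : ℕ} (hij : i < j) (hj : j < N) :
    s j * at' s i j * s j = at' s i j * s j * at' s i j := by
  induction j, hij using Nat.le_induction with
  | base => rw [at_self, ← h.braid i hj]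
  | succ j hij ih =>
    have ih := ih (by omega)
    have e : at' s i (j + 1) = at' s i j * s j * (at' s i j)⁻¹ := by
      rw [at_succ, eq_mul_inv_iff_mul_eq, mul_assoc, mul_assoc, inv_mul_eq_iff_eq_mul, ← mul_assoc,
        ← ih, mul_assoc]
    have c : s (j+1) * at' s i j = at' s i j * s (j+1) :=
      (h.at_comm_gt hij (by omega) (by omega)).eq
    rw [e]
    set x := at' s i j
    have c' : x⁻¹ * s (j+1) = s (j+1) * x⁻¹ := by
      rw [inv_mul_eq_iff_eq_mul, ← mul_assoc, ← c]; group
    calc _ = (s (j+1) * x) * s j * (x⁻¹ * s (j+1)) := by group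
      _ = x * (s (j+1) * s j * s (j+1)) * x⁻¹ := by rw [c, c']; group
      _ = x * s j * s (j+1) * (s j * x⁻¹) := by rw [← h.braid j hj]; group
      _ = x * s j * (s (j+1) * x⁻¹) * x * (s j * x⁻¹) := by group
      _ = _ := by rw [← c']; group

theorem at_tri1 (h : BrSeq N s) {i j l : ℕ} (hij : i < j) (hjl : j < l) (hl : l ≤ N) :
    at' s i j * at' s j l = at' s j l * at' s i l := by
  have c : Commute ((dd s (j+1))⁻¹ * dd s l) (at' s i j) :=
    comm_D (by omega) fun p h1 h2 => h.at_comm_gt hij (by omega) (by omega)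
  have e1 : at' s j l = ((dd s (j+1))⁻¹ * dd s l)⁻¹ * s j * ((dd s (j+1))⁻¹ * dd s l) := by
    simp only [at', dd]; group
  have e2 : at' s i l = (s j * ((dd s (j+1))⁻¹ * dd s l))⁻¹ * at' s i j *
      (s j * ((dd s (j+1))⁻¹ * dd s l)) := by
    simp only [at', dd]; group
  have c' := c.eq
  rw [e1, e2]
  set x := at' s i j
  set d := (dd s (j+1))⁻¹ * dd s l
  have c2 : x * d⁻¹ = d⁻¹ * x := by rw [mul_inv_eq_iff_eq_mul, mul_assoc, ← c']; group
  calc _ = (x * d⁻¹) * s j * d := by group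
    _ = _ := by rw [c2]; group

theorem at_tri2 (h : BrSeq N s) {i j l : ℕ} (hij : i < j) (hjl : j < l) (hl : l ≤ N) :
    at' s j l * at' s i l = at' s i l * at' s i j := by
  have c : Commute ((dd s (j+1))⁻¹ * dd s l) (at' s i j) :=
    comm_D (by omega) fun p h1 h2 => h.at_comm_gt hij (by omega) (by omega)
  have e1 : at' s j l = ((dd s (j+1))⁻¹ * dd s l)⁻¹ * s j * ((dd s (j+1))⁻¹ * dd s l) := by
    simp only [at', dd]; group
  have e2 : at' s i l = (s j * ((dd s (j+1))⁻¹ * dd s l))⁻¹ * at' s i j *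
      (s j * ((dd s (j+1))⁻¹ * dd s l)) := by
    simp only [at', dd]; group
  have c' := c.eq
  have b := h.at_braid hij (by omega)
  rw [e1, e2]
  set x := at' s i j
  set d := (dd s (j+1))⁻¹ * dd s l
  have b' : (s j)⁻¹ * x * s j * x = x * s j := by
    rw [mul_assoc, mul_assoc, inv_mul_eq_iff_eq_mul, ← mul_assoc, ← b]; group
  calc _ = d⁻¹ * (x * s j) * d := by group
    _ = d⁻¹ * ((s j)⁻¹ * x * s j) * (x * d) := by rw [← b']; group
    _ = _ := by rw [← c']; group

end BrSeq

open Equiv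

namespace NC

variable {G : Type*} [Group G] {N : ℕ} {s : ℕ → G}

/-- conjugation of reflections, same-side case -/
theorem same_conj (h : BrSeq N s) {i j k l : Fin (N + 1)} (hij : i < j) (hkl : k < l)
    (hs : k ∈ Set.Ico i j ↔ l ∈ Set.Ico i j) :
    ∃ p q : Fin (N + 1), p < q ∧ swap i j * swap k l = swap k l * swap p q ∧
      BrSeq.at' s i j * BrSeq.at' s k l = BrSeq.at' s k l * BrSeq.at' s p q := by
  have hj : (j : ℕ) < N + 1 := j.2
  have hl : (l : ℕ) < N + 1 := l.2
  have base : swap i j * swap k l = swap k l * swap (swap k l i) (swap k l j) := by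
    rw [swap_mul_eq_mul_swap, swap_inv]
  rcases lt_trichotomy i k with hik | rfl | hik
  · rcases lt_trichotomy k j with hkj | rfl | hkj
    · have hlj : l < j := (hs.1 ⟨hik.le, hkj⟩).2
      refine ⟨i, j, hij, ?_, ?_⟩
      · rw [base, swap_apply_of_ne_of_ne hik.ne (hik.trans hkl).ne,
          swap_apply_of_ne_of_ne hkj.ne' hlj.ne']
      · exact (h.at_nest hik hkl hlj (by omega)).eq.symm
    · refine ⟨i, l, hik.trans hkl, ?_, h.at_tri1 hij hkl (by omega)⟩
      rw [base, swap_apply_left, swap_apply_of_ne_of_ne hik.ne (hik.trans hkl).ne]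
    · refine ⟨i, j, hij, ?_, (h.at_disj hij hkj hkl (by omega)).eq.symm⟩
      rw [base, swap_apply_of_ne_of_ne hik.ne (hik.trans hkl).ne,
          swap_apply_of_ne_of_ne hkj.ne (hkj.trans hkl).ne]
  · have hlj : l < j := (hs.1 ⟨le_rfl, hij⟩).2
    refine ⟨l, j, hlj, ?_, ?_⟩
    · rw [base, swap_apply_left, swap_apply_of_ne_of_ne hij.ne' hlj.ne']
    · exact ((h.at_tri1 hkl hlj (by omega)).trans (h.at_tri2 hkl hlj (by omega))).symm
  · have hk : ¬ (l ∈ Set.Ico i j) := fun h1 => absurd (hs.2 h1).1 (not_le.2 hik)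
    rcases lt_or_ge l i with hli | hil
    · refine ⟨i, j, hij, ?_, (h.at_disj hkl hli hij (by omega)).eq⟩
      rw [base, swap_apply_of_ne_of_ne hik.ne' hli.ne',
          swap_apply_of_ne_of_ne (hik.trans hij).ne' (hli.trans hij).ne']
    · have hjl : j ≤ l := by
        by_contra! h1; exact hk ⟨hil, h1⟩
      rcases hjl.eq_or_lt with rfl | hjl
      · refine ⟨k, i, hik, ?_, h.at_tri2 hik hij (by omega)⟩
        rw [base, swap_apply_right, swap_apply_of_ne_of_ne hik.ne' hij.ne, swap_comm i k]
      · refine ⟨i, j, hij, ?_, (h.at_nest hik hij hjl (by omega)).eq⟩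
        rw [base, swap_apply_of_ne_of_ne hik.ne' (hij.trans hjl).ne,
          swap_apply_of_ne_of_ne (hik.trans hij).ne' hjl.ne]

/-- `x` is represented by a reduced factorization of `a` -/
inductive Rep (s : ℕ → G) : Perm (Fin (N + 1)) → G → Prop
  | one : Rep s 1 1
  | cons (a : Perm (Fin (N + 1))) (i j : Fin (N + 1)) (y : G) (hij : i < j) (hs : sim a i j)
      (h : Rep s (swap i j * a) y) : Rep s a (BrSeq.at' s i j * y)

theorem len_swap_mul {a : Perm (Fin (N + 1))} (hQ : Q a) {i j : Fin (N + 1)} (hij : i < j)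
    (hs : sim a i j) : 1 + len.l (swap i j * a) = len.l a := by
  have := hQ.swap_le hij hs
  unfold LenFn.le at this
  rw [len_swap hij.ne, swap_inv] at this
  exact this

theorem Rep.exists_of (s : ℕ → G) (K : ℕ) : ∀ a : Perm (Fin (N + 1)), Q a → len.l a ≤ K →
    ∃ x, Rep s a x := by
  induction K with
  | zero =>
    intro a _ h
    rw [len.eq_one a (by omega)]
    exact ⟨1, .one⟩
  | succ K ih =>
    intro a hQ h
    by_cases ha : a = 1
    · rw [ha]; exact ⟨1, .one⟩
    · obtain ⟨i, j, hij, h1⟩ := exists_atom a ha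
      have hs := sim_of_swap_le h1
      have := len_swap_mul hQ hij hs
      obtain ⟨y, hy⟩ := ih (swap i j * a) (hQ.swap_mul hij hs) (by omega)
      exact ⟨_, .cons a i j y hij hs hy⟩

theorem not_sim_one {i j : Fin (N + 1)} (hij : i < j) : ¬ sim 1 i j := by
  intro h
  have := h (ind {i}) (fun x => rfl)
  rw [ind_eq] at this
  simp only [Set.mem_singleton_iff, true_iff] at this
  exact hij.ne' this

theorem Rep.uniq (hB : BrSeq N s) (K : ℕ) : ∀ a : Perm (Fin (N + 1)), Q a → len.l a ≤ K →
    ∀ x x', Rep s a x → Rep s a x' → x = x' := by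
  induction K with
  | zero =>
    intro a _ h x x' h1 h2
    obtain rfl := len.eq_one a (by omega)
    cases h1 with
    | one => cases h2 with
      | one => rfl
      | cons _ i j y hij hs h => exact absurd hs (not_sim_one hij)
    | cons _ i j y hij hs h => exact absurd hs (not_sim_one hij)
  | succ K ih =>
    intro a hQ hK
    have same : ∀ (i j k l : Fin (N + 1)) (y y' : G), i < j → k < l → sim a i j → sim a k l →
        Rep s (swap i j * a) y → Rep s (swap k l * a) y' →
        (k ∈ Set.Ico i j ↔ l ∈ Set.Ico i j) →
        BrSeq.at' s i j * y = BrSeq.at' s k l * y' := by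
      intro i j k l y y' hij hkl h1 h2 hy hy' hs
      obtain ⟨p, q, hpq, e1, e2⟩ := same_conj hB hij hkl hs
      obtain ⟨g1, g2, g3⟩ := same_le hQ hij hkl h1 h2 hs
      have q1 := hQ.swap_mul hij h1
      have q2 := hQ.swap_mul hkl h2
      have l1 := len_swap_mul hQ hij h1
      have l2 := len_swap_mul hQ hkl h2
      have s1 : sim (swap i j * a) k l := (hQ.sim_swap_mul hij h1).2 ⟨h2, hs⟩
      have s2 : sim (swap k l * a) p q := by
        apply sim_of_swap_le
        have := (g3.translate (g3.trans g1)).2 g1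
        rw [e1, inv_mul_cancel_left, swap_inv] at this
        exact this
      obtain ⟨w, hw⟩ := Rep.exists_of s _ _ (q1.swap_mul hkl s1) le_rfl
      have e3 : y = BrSeq.at' s k l * w :=
        ih _ q1 (by omega) _ _ hy (.cons _ k l w hkl s1 hw)
      have e4 : y' = BrSeq.at' s p q * w := by
        refine ih _ q2 (by omega) _ _ hy' (.cons _ p q w hpq s2 ?_)
        have : swap p q * (swap k l * a) = swap k l * (swap i j * a) := by
          have : swap p q = swap k l * (swap i j * swap k l) := by
            rw [e1, ← mul_assoc, swap_mul_self, one_mul]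
          rw [this]
          simp only [mul_assoc]
          rw [← mul_assoc (swap k l) (swap k l) a, swap_mul_self, one_mul]
        rw [this]; exact hw
      rw [e3, e4, ← mul_assoc, e2, mul_assoc]
    have cross : ∀ (i j k l : Fin (N + 1)) (y y' : G), i < j → k < l → sim a i j → sim a k l →
        Rep s (swap i j * a) y → Rep s (swap k l * a) y' →
        i < k → k < j → j < l →
        BrSeq.at' s i j * y = BrSeq.at' s k l * y' := by
      intro i j k l y y' hij hkl h1 h2 hy hy' hik hkj hjl
      have h3 := cross_sim hQ hik hkj hjl h1 h2
      obtain ⟨w, hw⟩ := Rep.exists_of s _ _ (hQ.swap_mul hik h3) le_rfl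
      rw [same i j i k y w hij hik h1 h3 hy hw, same i k k l w y' hik hkl h3 h2 hw hy']
      · simp only [Set.mem_Ico, Fin.lt_def, Fin.le_def] at *; omega
      · simp only [Set.mem_Ico, Fin.lt_def, Fin.le_def] at *; omega
    intro x x' hx hx'
    cases hx with
    | one => cases hx' with
      | one => rfl
      | cons _ i j y hij hs h => exact absurd hs (not_sim_one hij)
    | cons _ i j y hij h1 hy => cases hx' with
      | one => exact absurd h1 (not_sim_one hij)
      | cons _ k l y' hkl h2 hy' =>
        rcases pair_cases hij hkl with h | h | ⟨rfl, rfl⟩ | ⟨h3, h4, h5⟩ | ⟨h3, h4, h5⟩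
        · exact same _ _ _ _ _ _ hij hkl h1 h2 hy hy' h
        · exact (same _ _ _ _ _ _ hkl hij h2 h1 hy' hy h).symm
        · have l1 := len_swap_mul hQ hij h1
          rw [ih _ (hQ.swap_mul hij h1) (by omega) _ _ hy hy']
        · exact cross _ _ _ _ _ _ hij hkl h1 h2 hy hy' h3 h4 h5
        · exact (cross _ _ _ _ _ _ hkl hij h2 h1 hy' hy h3 h4 h5).symm

open Classical in
/-- lift of a noncrossing permutation -/
noncomputable def br (s : ℕ → G) (a : Perm (Fin (N + 1))) : G :=
  if h : ∃ x, Rep s a x then h.choose else 1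

theorem br_rep (s : ℕ → G) {a : Perm (Fin (N + 1))} (hQ : Q a) : Rep s a (br s a) := by
  have h := Rep.exists_of s _ a hQ le_rfl
  rw [br, dif_pos h]
  exact h.choose_spec

theorem br_eq (hB : BrSeq N s) {a : Perm (Fin (N + 1))} (hQ : Q a) {x : G} (hx : Rep s a x) :
    br s a = x :=
  Rep.uniq hB _ a hQ le_rfl _ _ (br_rep s hQ) hx

theorem Q_one : Q (1 : Perm (Fin (N + 1))) := by
  intro i j hij hs
  exact absurd hs (not_sim_one hij)

theorem br_one (hB : BrSeq N s) : br s (1 : Perm (Fin (N + 1))) = 1 :=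
  br_eq hB Q_one .one

theorem br_cons (hB : BrSeq N s) {a : Perm (Fin (N + 1))} (hQ : Q a) {i j : Fin (N + 1)}
    (hij : i < j) (hs : sim a i j) : br s a = BrSeq.at' s i j * br s (swap i j * a) :=
  br_eq hB hQ (.cons _ i j _ hij hs (br_rep s (hQ.swap_mul hij hs)))

theorem br_mul (hB : BrSeq N s) {c : Perm (Fin (N + 1))} (hc : Q c) (K : ℕ) :
    ∀ a b : Perm (Fin (N + 1)), len.l a ≤ K → len.le a (a * b) → len.le (a * b) c →
    br s (a * b) = br s a * br s b := by
  have hQ : ∀ a, len.le a c → Q a := fun a ha => Q_of_le hc _ a ha le_rfl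
  induction K with
  | zero =>
    intro a b h _ _
    rw [len.eq_one a (by omega), br_one hB, one_mul, one_mul]
  | succ K ih =>
    intro a b h h1 h2
    by_cases ha : a = 1
    · rw [ha, br_one hB, one_mul, one_mul]
    · obtain ⟨i, j, hij, h3⟩ := exists_atom a ha
      have hs := sim_of_swap_le h3
      have hs2 := sim_of_swap_le (h3.trans h1)
      have qa := hQ a (h1.trans h2)
      have l1 := len_swap_mul qa hij hs
      rw [br_cons hB qa hij hs, br_cons hB (hQ _ h2) hij hs2, ← mul_assoc (swap i j), ih, mul_assoc]
      · omega
      · have := (h3.translate (h3.trans h1)).2 h1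
        rw [swap_inv, ← mul_assoc] at this
        exact this
      · have := (h3.trans h1).sub h2
        rw [swap_inv, ← mul_assoc] at this
        exact this

theorem br_swap (hB : BrSeq N s) {i j : Fin (N + 1)} (hij : i < j) (hQ : Q (swap i j)) :
    br s (swap i j) = BrSeq.at' s i j := by
  rw [br_cons hB hQ hij (sim_of_swap_le (LenFn.le_refl _ _)), swap_mul_self, br_one hB, mul_one]

end NC

open Equiv

namespace NC

variable {m : ℕ}

theorem sim_rot (m : ℕ) (i j : Fin (m + 1)) : sim (finRotate (m + 1)) i j := by
  have key : ∀ v ∈ Fix (finRotate (m + 1)), ∀ k, ∀ x : Fin (m + 1), x.val = k → v x = v 0 := by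
    intro v hv k
    induction k with
    | zero => intro x hx; rw [show x = 0 from Fin.ext hx]
    | succ k ih =>
      intro x hx
      have hk : k < m + 1 := by omega
      rw [← ih ⟨k, hk⟩ rfl, ← hv ⟨k, hk⟩, finRotate_apply]
      congr 1
      apply Fin.ext
      rw [Fin.val_add_one_of_lt, hx]
      rw [Fin.lt_def, Fin.val_last]
      simp only
      omega
  intro v hv
  rw [key v hv _ i rfl, key v hv _ j rfl]

theorem swap_le_rot {i j : Fin (m + 1)} (hij : i < j) : len.le (swap i j) (finRotate (m + 1)) :=
  (Q_rot m).swap_le hij (sim_rot m i j)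

open Classical in
/-- generators of the monoid -/
noncomputable def el (m : ℕ) (a : Perm (Fin (m + 1))) : (alg m).Mon :=
  if h : len.le a (finRotate (m + 1)) then (alg m).of ⟨a, h⟩ else 1

theorem el_of (a : S m) : (alg m).of a = el m a.1 := by
  rw [el, dif_pos a.2]

theorem el_one : el m 1 = 1 := by
  rw [← (alg m).of_e, el_of]
  rfl

theorem el_mul {a b : Perm (Fin (m + 1))} (h1 : len.le a (a * b))
    (h2 : len.le (a * b) (finRotate (m + 1))) : el m (a * b) = el m a * el m b := by
  have h := (alg m).of_comp ⟨a, h1.trans h2⟩ ⟨a * b, h2⟩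
  rw [el_of, el_of, el_of, el_of] at h
  obtain ⟨J, ⟨j1, j2, j3, j4⟩, e1, e2⟩ := LenFn.interval_cmp (exists_joins (Q_rot m))
    ⟨a, h1.trans h2⟩ ⟨a * b, h2⟩
  have hJ : J = a * b := (j4 _ h2 h1 (LenFn.le_refl _ _)).antisymm j3
  simp only [hJ, inv_mul_cancel, inv_mul_cancel_left] at e1 e2
  have e1' : (((alg m).cmp ⟨a, h1.trans h2⟩ ⟨a * b, h2⟩ : S m) : Perm (Fin (m + 1))) = b := e1
  have e2' : (((alg m).cmp ⟨a * b, h2⟩ ⟨a, h1.trans h2⟩ : S m) : Perm (Fin (m + 1))) = 1 := e2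
  rw [e1', e2', el_one, mul_one] at h
  exact h.symm

theorem el_swap_mul {i j k l : Fin (m + 1)} (hij : i < j) (hkl : k < l)
    (hs : k ∈ Set.Ico i j ↔ l ∈ Set.Ico i j) :
    el m (swap i j * swap k l) = el m (swap i j) * el m (swap k l) := by
  obtain ⟨g1, g2, g3⟩ := same_le (Q_rot m) hij hkl (sim_rot m i j) (sim_rot m k l) hs
  exact el_mul g2 g1

theorem el_tri1 {i j l : Fin (m + 1)} (hij : i < j) (hjl : j < l) :
    el m (swap i j) * el m (swap j l) = el m (swap j l) * el m (swap i l) := by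
  rw [← el_swap_mul hij hjl, ← el_swap_mul hjl (hij.trans hjl)]
  · congr 1
    rw [swap_mul_eq_mul_swap, swap_inv, swap_apply_left,
      swap_apply_of_ne_of_ne hij.ne (hij.trans hjl).ne]
  all_goals simp only [Set.mem_Ico, Fin.lt_def, Fin.le_def] at *; omega

theorem el_tri2 {i j l : Fin (m + 1)} (hij : i < j) (hjl : j < l) :
    el m (swap j l) * el m (swap i l) = el m (swap i l) * el m (swap i j) := by
  rw [← el_swap_mul hjl (hij.trans hjl), ← el_swap_mul (hij.trans hjl) hij]
  · congr 1
    rw [swap_mul_eq_mul_swap, swap_inv, swap_apply_right,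
      swap_apply_of_ne_of_ne hij.ne' hjl.ne, swap_comm i j]
  all_goals simp only [Set.mem_Ico, Fin.lt_def, Fin.le_def] at *; omega

theorem el_comm {i j k l : Fin (m + 1)} (hij : i < j) (hjk : j < k) (hkl : k < l) :
    el m (swap i j) * el m (swap k l) = el m (swap k l) * el m (swap i j) := by
  rw [← el_swap_mul hij hkl, ← el_swap_mul hkl hij]
  · congr 1
    rw [swap_mul_eq_mul_swap, swap_inv, swap_apply_of_ne_of_ne hjk.ne (hjk.trans hkl).ne,
      swap_apply_of_ne_of_ne (hij.trans hjk).ne (hij.trans (hjk.trans hkl)).ne]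
  all_goals simp only [Set.mem_Ico, Fin.lt_def, Fin.le_def] at *; omega

/-- the natural map to a group with braid relations -/
noncomputable def rho {G : Type*} [Group G] {s : ℕ → G} (hB : BrSeq m s) : (alg m).Mon →* G :=
  (alg m).lift (fun a => br s a.1) (br_one hB) (by
    intro a b
    obtain ⟨J, ⟨j1, j2, j3, j4⟩, e1, e2⟩ := LenFn.interval_cmp (exists_joins (Q_rot m)) a b
    have e1' : (((alg m).cmp a b : S m) : Perm (Fin (m + 1))) = a.1⁻¹ * J := e1
    have e2' : (((alg m).cmp b a : S m) : Perm (Fin (m + 1))) = b.1⁻¹ * J := e2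
    rw [e1', e2', ← br_mul hB (Q_rot m) _ a.1 _ le_rfl, ← br_mul hB (Q_rot m) _ b.1 _ le_rfl,
      mul_inv_cancel_left, mul_inv_cancel_left]
    all_goals simpa only [mul_inv_cancel_left])

theorem rho_of {G : Type*} [Group G] {s : ℕ → G} (hB : BrSeq m s) (a : S m) :
    rho hB ((alg m).of a) = br s a.1 := rfl

theorem rho_el {G : Type*} [Group G] {s : ℕ → G} (hB : BrSeq m s) {a : Perm (Fin (m + 1))}
    (ha : len.le a (finRotate (m + 1))) : rho hB (el m a) = br s a := by
  rw [el, dif_pos ha]; rfl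

theorem rho_swap {G : Type*} [Group G] {s : ℕ → G} (hB : BrSeq m s) {i j : Fin (m + 1)}
    (hij : i < j) : rho hB (el m (swap i j)) = BrSeq.at' s i j := by
  rw [rho_el hB (swap_le_rot hij), br_swap hB hij (S_Q (swap_le_rot hij))]

theorem br_rot {G : Type*} [Group G] {s : ℕ → G} (hB : BrSeq m s) :
    br s (finRotate (m + 1)) = BrSeq.dd s m := by
  have key : ∀ k, k ≤ m → ∃ d : Perm (Fin (m + 1)), Q d ∧
      br s (finRotate (m + 1)) = BrSeq.dd s k * br s d ∧
      (∀ x : Fin (m + 1), x.val < k → d x = x) ∧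
      (∀ x : Fin (m + 1), k ≤ x.val → x.val < m → (d x).val = x.val + 1) := by
    intro k
    induction k with
    | zero =>
      intro _
      refine ⟨_, Q_rot m, by simp [BrSeq.dd], by simp, ?_⟩
      intro x _ hx
      rw [finRotate_apply, Fin.val_add_one_of_lt]
      rw [Fin.lt_def, Fin.val_last]; exact hx
    | succ k ih =>
      intro hk
      obtain ⟨d, hQ, h1, h2, h3⟩ := ih (by omega)
      let i : Fin (m + 1) := ⟨k, by omega⟩
      let j : Fin (m + 1) := ⟨k + 1, by omega⟩
      have hdi : d i = j := Fin.ext (h3 i le_rfl (by simp only [i]; omega))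
      have hij : i < j := by rw [Fin.lt_def]; simp [i, j]
      have hs : sim d i j := by
        have := sim_apply d i
        rwa [hdi] at this
      refine ⟨swap i j * d, hQ.swap_mul hij hs, ?_, ?_, ?_⟩
      · rw [h1, br_cons hB hQ hij hs, BrSeq.dd, mul_assoc]
        congr 2
        exact BrSeq.at_self s k
      · intro x hx
        rw [Perm.mul_apply]
        rcases Nat.lt_or_ge x.val k with h | h
        · rw [h2 x h]
          apply swap_apply_of_ne_of_ne
          · rw [Ne, Fin.ext_iff]; simp only [i]; omega
          · rw [Ne, Fin.ext_iff]; simp only [j]; omega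
        · have : x = i := Fin.ext (by simp only [i]; omega)
          rw [this, hdi, swap_apply_right]
      · intro x hx hxm
        rw [Perm.mul_apply]
        have e := h3 x (by omega) hxm
        rw [swap_apply_of_ne_of_ne, e]
        · rw [Ne, Fin.ext_iff, e]; simp only [i]; omega
        · rw [Ne, Fin.ext_iff, e]; simp only [j]; omega
  obtain ⟨d, hQ, h1, h2, h3⟩ := key m le_rfl
  have hd : d = 1 := by
    ext1 x
    rcases Nat.lt_or_ge x.val m with h | h
    · exact h2 x h
    · by_contra hne
      have hne : d x ≠ x := hne
      have h4 : (d x).val < m := by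
        have := (d x).2
        have h5 : (d x).val ≠ x.val := fun h => hne (Fin.ext h)
        omega
      exact hne (d.injective (h2 _ h4))
  rw [h1, hd, br_one hB, mul_one]

theorem rho_top {G : Type*} [Group G] {s : ℕ → G} (hB : BrSeq m s) :
    rho hB ((alg m).of (top m)) = BrSeq.dd s m := br_rot hB

/-- index -/
def ix (m k : ℕ) : Fin (m + 1) := if h : k < m + 1 then ⟨k, h⟩ else 0

theorem ix_lt {i j : ℕ} (hij : i < j) (hj : j < m + 1) : ix m i < ix m j := by
  rw [ix, ix, dif_pos hj, dif_pos (by omega : i < m + 1)]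
  exact hij

theorem ix_val (i : Fin (m + 1)) : ix m i.val = i := by
  rw [ix, dif_pos i.2]

theorem sbr (m : ℕ) : BrSeq m (sigmaN (m + 1)) := sigmaN_brSeq (m + 1)

/-- the monoid embeds in a group in which the braid group maps -/
theorem rho_injective (m : ℕ) :
    Function.Injective (rho (sbr m)) := by
  obtain ⟨L, _, ι, hι, hu⟩ := (alg_top m).exists_group
  let f : (alg m).Mon →* Lˣ := IsUnit.liftRight ι hu
  have hf : Function.Injective f := by
    intro x y h
    apply hι
    have := congrArg (Units.val) h
    exact this
  let u : ℕ → Lˣ := fun k => f (el m (swap (ix m k) (ix m (k + 1))))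
  have hB : BrSeq m u := by
    constructor
    · intro i j hij hj
      simp only [u, ← map_mul]
      rw [el_comm (ix_lt (by omega) (by omega)) (ix_lt hij (by omega)) (ix_lt (by omega) (by omega))]
    · intro i hi
      simp only [u, ← map_mul]
      have h1 := el_tri1 (ix_lt (m := m) (Nat.lt_succ_self i) (by omega))
        (ix_lt (Nat.lt_succ_self (i+1)) (by omega))
      have h2 := el_tri2 (ix_lt (m := m) (Nat.lt_succ_self i) (by omega))
        (ix_lt (Nat.lt_succ_self (i+1)) (by omega))
      simp only [Nat.succ_eq_add_one] at h1 h2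
      rw [h1, mul_assoc, ← h2, ← h1, ← mul_assoc]
  let ψ : BraidGroup (m + 1) →* Lˣ := braidLift u hB
  have hψ : ∀ k, k < m → ψ (sigmaN (m + 1) k) = u k := fun k hk => braidLift_sigmaN (n := m + 1) u hB k hk
  have hat : ∀ i j, i < j → j ≤ m → ψ (BrSeq.at' (sigmaN (m + 1)) i j) =
      f (el m (swap (ix m i) (ix m j))) := by
    intro i j hij
    induction j, hij using Nat.le_induction with
    | base =>
      intro hi
      rw [BrSeq.at_self, hψ i (by omega)]
    | succ j hij ih =>
      intro hj
      have hij : i < j := hij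
      rw [BrSeq.at_succ, map_mul, map_mul, map_inv, hψ j (by omega), ih (by omega), mul_assoc,
        inv_mul_eq_iff_eq_mul]
      simp only [u, ← map_mul]
      rw [el_tri1 (ix_lt hij (by omega)) (ix_lt (by omega) (by omega))]
  have hbr : ∀ K, ∀ a : Perm (Fin (m + 1)), len.le a (finRotate (m + 1)) → len.l a ≤ K →
      ψ (br (sigmaN (m + 1)) a) = f (el m a) := by
    intro K
    induction K with
    | zero =>
      intro a _ h
      rw [len.eq_one a (by omega), br_one (sbr m), el_one, map_one, map_one]
    | succ K ih =>
      intro a hac h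
      by_cases ha : a = 1
      · rw [ha, br_one (sbr m), el_one, map_one, map_one]
      · obtain ⟨i, j, hij, h3⟩ := exists_atom a ha
        have hs := sim_of_swap_le h3
        have qa := S_Q hac
        have l1 := len_swap_mul qa hij hs
        have h4 := h3.sub hac
        rw [swap_inv] at h4
        rw [br_cons (sbr m) qa hij hs, map_mul, ih _ h4 (by omega),
          hat _ _ hij (by omega), ix_val, ix_val, ← map_mul, ← el_mul, swap_mul_self_mul]
        · rw [swap_mul_self_mul]; exact h3
        · rw [swap_mul_self_mul]; exact hac
  have hcomp : ∀ x, ψ (rho (sbr m) x) = f x := by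
    intro x
    induction x using (alg m).mon_induction with
    | h1 => simp
    | hs a x ih => rw [map_mul, map_mul, map_mul, ih, rho_of, hbr _ _ a.2 le_rfl, el_of]
  intro x y h
  apply hf
  rw [← hcomp, ← hcomp, h]

end NC

namespace NC

variable {m : ℕ}

theorem rho_top' (m : ℕ) : rho (sbr m) ((alg m).of (top m)) = deltaBraid (m + 1) := by
  rw [rho_top, deltaBraid_eq]; rfl

theorem rho_Z (m : ℕ) : rho (sbr m) ((alg m).of (top m) ^ (m + 1)) = zBraid (m + 1) := by
  rw [map_pow, rho_top', zBraid]; rfl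

theorem rho_gen (g : BraidGroup (m + 1)) :
    ∃ (x : (alg m).Mon) (k : ℕ), g * zBraid (m + 1) ^ k = rho (sbr m) x := by
  induction g using braid_induction with
  | hs i hi =>
    have hi : i < m := hi
    refine ⟨el m (Equiv.swap (⟨i, by omega⟩ : Fin (m + 1)) ⟨i + 1, by omega⟩), 0, ?_⟩
    rw [rho_swap, pow_zero, mul_one]
    · exact (BrSeq.at_self _ i).symm
    · rw [Fin.lt_def]; simp
  | h1 => exact ⟨1, 0, by simp⟩
  | hm x y hx hy =>
    obtain ⟨a, k, ha⟩ := hx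
    obtain ⟨b, l, hb⟩ := hy
    refine ⟨a * b, k + l, ?_⟩
    rw [map_mul, ← ha, ← hb, pow_add]
    have := ((zBraid_comm (m + 1) y).pow_left k).eq
    simp only [mul_assoc]
    rw [← mul_assoc (zBraid (m + 1) ^ k) y, this]; simp only [mul_assoc]
  | hi x hx =>
    obtain ⟨a, k, ha⟩ := hx
    obtain ⟨l, b, hb⟩ := (alg_top m).dvd_powZ a
    refine ⟨((alg m).of (top m) ^ (m + 1)) ^ k * b, l, ?_⟩
    have h2 := congrArg (rho (sbr m)) hb
    rw [map_pow, rho_Z, map_mul, ← ha] at h2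
    rw [map_mul, map_pow, rho_Z, h2, ← mul_assoc, ← mul_assoc, inv_mul_cancel, one_mul]

theorem garside (D : BraidGroup (m + 1))
    (hD : ∀ x, ∃ x', D⁻¹ * rho (sbr m) x * D = rho (sbr m) x') (β : BraidGroup (m + 1)) (q : ℕ)
    (hq : 0 < q) (hT : ∀ g, β ^ q * g * D ^ q = g) : ∃ h, β * h * D = h := by
  refine garside_fixed_point (rho (sbr m)) (rho_injective m) (alg m).exists_lub (alg_no_units m)
    ((alg m).of (top m) ^ (m + 1)) ?_ ?_ D hD β q hq hT
  · rw [rho_Z]; exact zBraid_comm _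
  · rw [rho_Z]; exact rho_gen

theorem torsion_free (β : BraidGroup (m + 1)) (q : ℕ) (hq : 0 < q) (h : β ^ q = 1) : β = 1 := by
  obtain ⟨g, hg⟩ := garside 1 (fun x => ⟨x, by simp⟩) β q hq (by simp [h])
  simpa using hg

theorem delta_conj (x : (alg m).Mon) : ∃ x', (deltaBraid (m + 1))⁻¹ * rho (sbr m) x *
    deltaBraid (m + 1) = rho (sbr m) x' := by
  induction x using (alg m).mon_induction with
  | h1 => exact ⟨1, by simp⟩
  | hs a x ih =>
    obtain ⟨x', hx⟩ := ih
    have h := congrArg (rho (sbr m)) ((alg_top m).of_mul_d a)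
    rw [map_mul, map_mul, rho_top'] at h
    refine ⟨(alg m).of ((alg m).cmp ((alg m).cmp a (top m)) (top m)) * x', ?_⟩
    rw [map_mul, map_mul, ← hx]
    rw [← inv_mul_eq_iff_eq_mul] at h
    rw [← h]
    group

theorem delta_conj_pow (k : ℕ) (x : (alg m).Mon) : ∃ x', (deltaBraid (m + 1) ^ k)⁻¹ *
    rho (sbr m) x * deltaBraid (m + 1) ^ k = rho (sbr m) x' := by
  induction k with
  | zero => exact ⟨x, by simp⟩
  | succ k ih =>
    obtain ⟨y, hy⟩ := ih
    obtain ⟨w, hw⟩ := delta_conj y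
    refine ⟨w, ?_⟩
    rw [← hw, ← hy, pow_succ]; group

/-- The δ case. -/
theorem delta_case (β : BraidGroup (m + 1)) (q c : ℕ) (hq : 0 < q) (hc : m + 1 = c * q)
    (h : β ^ q = zBraid (m + 1)) : ∃ g, β * g = g * deltaBraid (m + 1) ^ c := by
  set δ := deltaBraid (m + 1) with hδ
  have hz : zBraid (m + 1) = δ ^ (m + 1) := rfl
  obtain ⟨g, hg⟩ := garside ((δ ^ c)⁻¹) (by
    intro x
    obtain ⟨y, hy⟩ := delta_conj_pow (m * c) x
    refine ⟨y, ?_⟩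
    rw [← hy, ← hδ]
    have h1 : Commute (zBraid (m + 1) ^ c) (rho (sbr m) x) := (zBraid_comm _ _).pow_left c
    have h2 : zBraid (m + 1) ^ c = δ ^ (m * c) * δ ^ c := by
      rw [hz, ← pow_mul, ← pow_add]; congr 1; ring
    have h3 := h1.eq
    rw [h2] at h3
    rw [inv_inv, mul_inv_eq_iff_eq_mul, mul_assoc, mul_assoc, ← h3]
    group) β q hq (by
    intro g
    rw [h, inv_pow, ← pow_mul, ← hc, ← hz, (zBraid_comm _ g).eq]
    group)
  refine ⟨g, ?_⟩
  rw [mul_inv_eq_iff_eq_mul] at hg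
  exact hg

end NC

namespace Ann

/-- free group -/
abbrev F (M : ℕ) := FreeGroup (Fin (M + 1))

variable {M : ℕ}

/-- generators of the free group -/
def y (M : ℕ) (k : ℕ) : F M := if h : k < M + 1 then FreeGroup.of ⟨k, h⟩ else 1

theorem y_val (x : Fin (M + 1)) : y M x.val = FreeGroup.of x := by rw [y, dif_pos x.2]

/-- lifting from the free group -/
def yl {G : Type*} [Group G] (f : ℕ → G) : F M →* G := FreeGroup.lift (fun x => f x.val)

theorem yl_y {G : Type*} [Group G] (f : ℕ → G) {k : ℕ} (hk : k ≤ M) :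
    yl (M := M) f (y M k) = f k := by
  rw [y, dif_pos (by omega)]; simp [yl]

theorem hom_ext {G : Type*} [Group G] {f g : F M →* G} (h : ∀ k ≤ M, f (y M k) = g (y M k)) :
    f = g := by
  apply FreeGroup.ext_hom
  intro x
  rw [← y_val]
  exact h _ (by omega)

theorem aut_ext {f g : MulAut (F M)} (h : ∀ k ≤ M, f (y M k) = g (y M k)) : f = g := by
  have : f.toMonoidHom = g.toMonoidHom := hom_ext h
  ext1 x
  exact DFunLike.congr_fun this x

/-- Artin action -/
def ar (M i : ℕ) : F M →* F M := yl fun k =>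
  if k = i then (y M i)⁻¹ * y M (i + 1) * y M i else if k = i + 1 then y M i else y M k

/-- inverse Artin action -/
def ar' (M i : ℕ) : F M →* F M := yl fun k =>
  if k = i then y M (i + 1) else if k = i + 1 then y M (i + 1) * y M i * (y M (i + 1))⁻¹ else y M k

theorem ar_y (i : ℕ) {k : ℕ} (hk : k ≤ M) : ar M i (y M k) =
  if k = i then (y M i)⁻¹ * y M (i + 1) * y M i else if k = i + 1 then y M i else y M k :=
  yl_y _ hk

theorem ar'_y (i : ℕ) {k : ℕ} (hk : k ≤ M) : ar' M i (y M k) =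
  if k = i then y M (i + 1) else if k = i + 1 then y M (i + 1) * y M i * (y M (i + 1))⁻¹ else y M k :=
  yl_y _ hk

/-- Artin automorphism -/
def arE (M i : ℕ) (hi : i < M) : MulAut (F M) :=
  MonoidHom.toMulEquiv (ar M i) (ar' M i)
    (by
      apply hom_ext
      intro k hk
      simp only [MonoidHom.comp_apply, MonoidHom.id_apply, ar_y i hk]
      split_ifs with h1 h2
      · subst h1
        simp only [map_mul, map_inv, ar'_y k hk, ar'_y k (show k + 1 ≤ M by omega)]
        simp [mul_assoc]
      · subst h2
        simp [ar'_y i (show i ≤ M by omega)]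
      · simp [ar'_y i hk, h1, h2])
    (by
      apply hom_ext
      intro k hk
      simp only [MonoidHom.comp_apply, MonoidHom.id_apply, ar'_y i hk]
      split_ifs with h1 h2
      · subst h1
        simp [ar_y k (show k + 1 ≤ M by omega)]
      · subst h2
        simp only [map_mul, map_inv, ar_y i hk, ar_y i (show i ≤ M by omega)]
        simp [mul_assoc]
      · simp [ar_y i hk, h1, h2])

/-- Artin automorphism, extended -/
def arA (M i : ℕ) : MulAut (F M) := if h : i < M then arE M i h else 1

theorem arA_y {i : ℕ} (hi : i < M) {k : ℕ} (hk : k ≤ M) : arA M i (y M k) =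
    if k = i then (y M i)⁻¹ * y M (i + 1) * y M i else if k = i + 1 then y M i else y M k := by
  rw [arA, dif_pos hi]
  exact ar_y i hk

theorem arA_self {i : ℕ} (hi : i < M) :
    arA M i (y M i) = (y M i)⁻¹ * y M (i + 1) * y M i := by
  rw [arA_y hi (by omega), if_pos rfl]

theorem arA_succ {i : ℕ} (hi : i < M) : arA M i (y M (i + 1)) = y M i := by
  rw [arA_y hi (by omega), if_neg (by omega), if_pos rfl]

theorem arA_ne {i : ℕ} (hi : i < M) {k : ℕ} (hk : k ≤ M) (h1 : k ≠ i) (h2 : k ≠ i + 1) :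
    arA M i (y M k) = y M k := by
  rw [arA_y hi hk, if_neg h1, if_neg h2]

theorem arA_brSeq (M : ℕ) : BrSeq M (arA M) := by
  constructor
  · intro i j hij hj
    apply aut_ext
    intro k hk
    simp only [MulAut.mul_apply]
    by_cases h1 : k = i
    · subst h1
      rw [arA_self (by omega), arA_ne hj hk (by omega) (by omega), arA_self (by omega)]
      simp only [map_mul, map_inv]
      rw [arA_ne hj hk (by omega) (by omega), arA_ne hj (by omega) (by omega) (by omega)]
    by_cases h2 : k = i + 1
    · subst h2
      rw [arA_succ (by omega), arA_ne hj hk (by omega) (by omega), arA_succ (by omega),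
        arA_ne hj (by omega) (by omega) (by omega)]
    rw [arA_ne (by omega) hk h1 h2]
    by_cases h3 : k = j
    · subst h3
      rw [arA_self (by omega)]
      simp only [map_mul, map_inv]
      rw [arA_ne (by omega) hk h1 h2, arA_ne (by omega) (by omega) (by omega) (by omega)]
    by_cases h4 : k = j + 1
    · subst h4
      rw [arA_succ hj, arA_ne (by omega) (by omega) (by omega) (by omega)]
    rw [arA_ne hj hk h3 h4, arA_ne (by omega) hk h1 h2]
  · intro i hi
    apply aut_ext
    intro k hk
    simp only [MulAut.mul_apply]
    by_cases h1 : k = i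
    · subst h1
      rw [arA_ne hi hk (by omega) (by omega), arA_self (by omega)]
      simp only [map_mul, map_inv]
      rw [arA_ne hi hk (by omega) (by omega), arA_self hi]
      simp only [map_mul, map_inv]
      rw [arA_self (by omega), arA_succ (by omega), arA_ne (by omega) (by omega) (by omega) (by omega)]
      group
    by_cases h2 : k = i + 1
    · subst h2
      rw [arA_succ (by omega), arA_ne hi (by omega) (by omega) (by omega), arA_self (by omega),
        arA_self hi]
      simp only [map_mul, map_inv]
      rw [arA_succ (by omega), arA_ne (by omega) (by omega) (by omega) (by omega)]
      rw [arA_ne (by omega : i < M) (by omega) (by omega) (by omega), arA_succ hi]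
    by_cases h3 : k = i + 1 + 1
    · subst h3
      rw [arA_ne (by omega) hk (by omega) (by omega), arA_succ hi, arA_succ (by omega),
        arA_ne hi (by omega) (by omega) (by omega)]
    rw [arA_ne (by omega) hk h1 h2, arA_ne hi hk h2 h3, arA_ne (by omega) hk h1 h2,
      arA_ne hi hk h2 h3]

/-- the Artin representation -/
def act (M : ℕ) : BraidGroup (M + 1) →* MulAut (F M) := braidLift (arA M) (arA_brSeq M)

theorem act_sigma {i : ℕ} (hi : i < M) : act M (sigmaN (M + 1) i) = arA M i :=
  braidLift_sigmaN (n := M + 1) _ _ i hi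

/-- annular braid group -/
abbrev K (M : ℕ) := F M ⋊[act M] BraidGroup (M + 1)

/-- free part -/
def ky (M k : ℕ) : K M := SemidirectProduct.inl (y M k)

/-- braid part -/
def ks (M k : ℕ) : K M := SemidirectProduct.inr (sigmaN (M + 1) k)

theorem ks_mul_inl {i : ℕ} (hi : i < M) (f : F M) :
    ks M i * (SemidirectProduct.inl f : K M) = SemidirectProduct.inl (arA M i f) * ks M i := by
  rw [← act_sigma hi]
  ext <;> simp [ks]

theorem ks_ky {i k : ℕ} (hi : i < M) (hk : k ≤ M) (h1 : k ≠ i) (h2 : k ≠ i + 1) :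
    ks M i * ky M k = ky M k * ks M i := by
  rw [ky, ks_mul_inl hi, arA_ne hi hk h1 h2]

theorem ks_ky_succ {i : ℕ} (hi : i < M) : ks M i * ky M (i + 1) = ky M i * ks M i := by
  rw [ky, ks_mul_inl hi, arA_succ hi, ky]

theorem ks_ky_self {i : ℕ} (hi : i < M) : 
    ks M i * (ky M (i + 1) * ky M i) = ky M (i + 1) * ky M i * ks M i := by
  rw [← mul_assoc, ks_ky_succ hi, ky, ky, mul_assoc, ks_mul_inl hi, arA_self hi]
  simp [mul_assoc]

theorem ks_brSeq (M : ℕ) : BrSeq M (ks M) :=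
  (NC.sbr M).map SemidirectProduct.inr

end Ann

open Equiv

namespace Ann

variable {M : ℕ}

/-- cocycle -/
def co (M i j : ℕ) : K M :=
  if M + 1 < j then 1 else if i + 1 < j then ks M i else if i + 1 = j then 1 else
  if i = j then ky M i else ks M (i - 1)

/-- generators of the action -/
def T (M i : ℕ) : Perm (ℕ × K M) :=
  Equiv.prodShear (swap i (i + 1)) (fun j => Equiv.mulLeft (co M i j))

theorem T_apply (i j : ℕ) (k : K M) : T M i (j, k) = (swap i (i + 1) j, co M i j * k) := rfl

theorem T_far {i j : ℕ} (hj : M + 1 < j) (hi : i ≤ M) (k : K M) : T M i (j, k) = (j, k) := by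
  rw [T_apply, co, if_pos hj, swap_apply_of_ne_of_ne (by omega) (by omega), one_mul]

theorem T_gt {i j : ℕ} (hj : j ≤ M + 1) (hi : i + 1 < j) (k : K M) :
    T M i (j, k) = (j, ks M i * k) := by
  rw [T_apply, co, if_neg (by omega), if_pos hi, swap_apply_of_ne_of_ne (by omega) (by omega)]

theorem T_succ {i : ℕ} (hi : i ≤ M) (k : K M) : T M i (i + 1, k) = (i, k) := by
  rw [T_apply, co, if_neg (by omega), if_neg (by omega), if_pos rfl, swap_apply_right, one_mul]

theorem T_self {i : ℕ} (hi : i ≤ M) (k : K M) : T M i (i, k) = (i + 1, ky M i * k) := by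
  rw [T_apply, co, if_neg (by omega), if_neg (by omega), if_neg (by omega), if_pos rfl,
    swap_apply_left]

theorem T_lt {i j : ℕ} (hj : j ≤ i) (hi : i < M) (k : K M) :
    T M (i + 1) (j, k) = (j, ks M i * k) := by
  rw [T_apply, co, if_neg (by omega), if_neg (by omega), if_neg (by omega), if_neg (by omega),
    swap_apply_of_ne_of_ne (by omega) (by omega)]
  rfl

theorem T_brSeq (M : ℕ) : BrSeq (M + 1) (T M) := by
  have cm := (ks_brSeq M).comm
  have br := (ks_brSeq M).braid
  constructor
  · intro i l hil hl
    obtain ⟨l, rfl⟩ : ∃ l', l = l' + 1 := ⟨l - 1, by omega⟩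
    ext1 ⟨j, k⟩
    simp only [Perm.mul_apply]
    rcases Nat.lt_or_ge (M + 1) j with hj | hj
    · have t1 := T_far (M := M) (i := i) (j := j) (by omega) (by omega)
      have t2 := T_far (M := M) (i := l + 1) (j := j) (by omega) (by omega)
      simp only [t1, t2]
    rcases lt_trichotomy j i with h | rfl | h
    · obtain ⟨i, rfl⟩ : ∃ i', i = i' + 1 := ⟨i - 1, by omega⟩
      have t1 := T_lt (M := M) (i := i) (j := j) (by omega) (by omega)
      have t2 := T_lt (M := M) (i := l) (j := j) (by omega) (by omega)
      simp only [t1, t2]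
      rw [← mul_assoc, ← mul_assoc, cm i l (by omega) (by omega)]
    · have t1 := T_self (M := M) (i := j) (by omega)
      have t2 := T_lt (M := M) (i := l) (j := j) (by omega) (by omega)
      have t3 := T_lt (M := M) (i := l) (j := j + 1) (by omega) (by omega)
      simp only [t1, t2, t3]
      rw [← mul_assoc, ← mul_assoc,
        ks_ky (by omega) (by omega) (by omega) (by omega)]
    rcases lt_trichotomy j (i + 1) with h' | rfl | h'
    · omega
    · have t1 := T_succ (M := M) (i := i) (by omega)
      have t2 := T_lt (M := M) (i := l) (j := i) (by omega) (by omega)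
      have t3 := T_lt (M := M) (i := l) (j := i + 1) (by omega) (by omega)
      simp only [t1, t2, t3]
    have t0 := T_gt hj h'
    rcases lt_trichotomy j (l + 1) with h2 | rfl | h2
    · have t2 := T_lt (M := M) (i := l) (j := j) (by omega) (by omega)
      simp only [t0, t2]
      rw [← mul_assoc, ← mul_assoc, cm i l (by omega) (by omega)]
    · have t1 := T_self (M := M) (i := l + 1) (by omega)
      have t2 := T_gt (M := M) (i := i) (j := l + 1 + 1) (by omega) (by omega)
      simp only [t0, t1, t2]
      rw [← mul_assoc,
        ← mul_assoc, ks_ky (by omega) (by omega) (by omega) (by omega)]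
    rcases lt_trichotomy j (l + 1 + 1) with h3 | rfl | h3
    · omega
    · have t1 := T_succ (M := M) (i := l + 1) (by omega)
      have t2 := T_gt (M := M) (i := i) (j := l + 1) (by omega) (by omega)
      simp only [t0, t1, t2]
    · have t2 := T_gt hj h3
      simp only [t0, t2]
      rw [← mul_assoc, ← mul_assoc,
        cm i (l + 1) (by omega) (by omega)]
  · intro i hi
    ext1 ⟨j, k⟩
    simp only [Perm.mul_apply]
    rcases Nat.lt_or_ge (M + 1) j with hj | hj
    · have t1 := T_far (M := M) (i := i) (j := j) (by omega) (by omega)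
      have t2 := T_far (M := M) (i := i + 1) (j := j) (by omega) (by omega)
      simp only [t1, t2]
    rcases lt_trichotomy j i with h | rfl | h
    · obtain ⟨i, rfl⟩ : ∃ i', i = i' + 1 := ⟨i - 1, by omega⟩
      have t1 := T_lt (M := M) (i := i) (j := j) (by omega) (by omega)
      have t2 := T_lt (M := M) (i := i + 1) (j := j) (by omega) (by omega)
      simp only [t1, t2]
      simp only [← mul_assoc]
      rw [br i (by omega)]
    · have t1 := T_self (M := M) (i := j) (by omega)
      have t2 := T_self (M := M) (i := j + 1) (by omega)
      have t3 := T_gt (M := M) (i := j) (j := j + 1 + 1) (by omega) (by omega)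
      have t4 := T_lt (M := M) (i := j) (j := j) (by omega) (by omega)
      simp only [t1, t2, t3, t4]
      have := ks_ky_self (M := M) (i := j) (by omega)
      simp only [← mul_assoc] at this ⊢
      rw [this]
    rcases lt_trichotomy j (i + 1) with h' | rfl | h'
    · omega
    · have t1 := T_succ (M := M) (i := i) (by omega)
      have t2 := T_lt (M := M) (i := i) (j := i) (by omega) (by omega)
      have t3 := T_self (M := M) (i := i) (by omega)
      have t4 := T_self (M := M) (i := i + 1) (by omega)
      have t5 := T_gt (M := M) (i := i) (j := i + 1 + 1) (by omega) (by omega)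
      have t6 := T_succ (M := M) (i := i + 1) (by omega)
      simp only [t1, t2, t3, t4, t5, t6]
      rw [← mul_assoc, ← mul_assoc, ks_ky_succ (by omega)]
    rcases lt_trichotomy j (i + 1 + 1) with h' | rfl | h'
    · omega
    · have t1 := T_succ (M := M) (i := i) (by omega)
      have t2 := T_lt (M := M) (i := i) (j := i) (by omega) (by omega)
      have t5 := T_gt (M := M) (i := i) (j := i + 1 + 1) (by omega) (by omega)
      have t6 := T_succ (M := M) (i := i + 1) (by omega)
      simp only [t1, t2, t5, t6]
    · have t5 := T_gt (M := M) (i := i) (j := j) (by omega) (by omega)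
      have t6 := T_gt (M := M) (i := i + 1) (j := j) (by omega) (by omega)
      simp only [t5, t6]
      simp only [← mul_assoc]
      rw [br i (by omega)]

/-- the action -/
def tw (M : ℕ) : BraidGroup (M + 2) →* Perm (ℕ × K M) := braidLift (T M) (T_brSeq M)

theorem tw_sigma {i : ℕ} (hi : i ≤ M) : tw M (sigmaN (M + 2) i) = T M i :=
  braidLift_sigmaN (n := M + 2) _ _ i (by omega)

theorem tw_right (g : BraidGroup (M + 2)) : ∀ (j : ℕ) (k l : K M),
    tw M g (j, k * l) = ((tw M g (j, k)).1, (tw M g (j, k)).2 * l) := by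
  induction g using braid_induction with
  | hs i hi =>
    intro j k l
    rw [tw_sigma (by omega), T_apply, T_apply, mul_assoc]
  | h1 => intro j k l; simp
  | hm x y hx hy =>
    intro j k l
    simp only [map_mul, Perm.mul_apply]
    rw [hy, hx]
  | hi x hx =>
    intro j k l
    rw [map_inv, Perm.inv_eq_iff_eq, hx]
    simp

/-- partial products in the big braid group -/
def rr (M j : ℕ) : BraidGroup (M + 2) :=
  (BrSeq.dd (sigmaN (M + 2)) j)⁻¹ * BrSeq.dd (sigmaN (M + 2)) (M + 1)

theorem rr_top : rr M (M + 1) = 1 := by simp [rr]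

theorem rr_succ (j : ℕ) : rr M j = sigmaN (M + 2) j * rr M (j + 1) := by
  simp only [rr, BrSeq.dd]; group

theorem rr_comm {i j : ℕ} (hij : i + 1 < j) (hj : j ≤ M + 1) :
    sigmaN (M + 2) i * rr M j = rr M j * sigmaN (M + 2) i := by
  have := BrSeq.comm_D (s := sigmaN (M + 2)) hj (x := sigmaN (M + 2) i) (by
    intro p h1 h2
    exact (sigmaN_comm (M + 2) i p (by omega)).symm)
  exact this.eq.symm

theorem rr_shift {i j : ℕ} (hij : j ≤ i) (hi : i < M) :
    sigmaN (M + 2) (i + 1) * rr M j = rr M j * sigmaN (M + 2) i := by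
  have h1 := (NC.sbr (M + 1)).dd_shift (k := M + 1) (i := i) (by omega) le_rfl
  have h2 := (NC.sbr (M + 1)).dd_comm (k := j) (j := i + 1) (by omega) (by omega)
  rw [rr, mul_assoc, h1, ← mul_assoc, ← mul_assoc]
  congr 1
  rw [eq_inv_mul_iff_mul_eq, ← mul_assoc, h2]
  group

/-- images of the free generators -/
def AA (M i : ℕ) : BraidGroup (M + 2) := BrSeq.at' (sigmaN (M + 2)) i (M + 1)

theorem AA_eq (i : ℕ) : AA M i = (rr M (i + 1))⁻¹ * sigmaN (M + 2) i * rr M (i + 1) := by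
  simp only [AA, BrSeq.at', rr, BrSeq.dd]; group

theorem AA_rel1 {i : ℕ} (hi : i < M) : sigmaN (M + 2) i * AA M (i + 1) = AA M i * sigmaN (M + 2) i := by
  have h1 := (NC.sbr (M + 1)).at_tri1 (i := i) (j := i + 1) (l := M + 1) (by omega) (by omega) le_rfl
  have h2 := (NC.sbr (M + 1)).at_tri2 (i := i) (j := i + 1) (l := M + 1) (by omega) (by omega) le_rfl
  rw [BrSeq.at_self] at h1 h2
  exact h1.trans h2

theorem AA_rel2 {i : ℕ} (hi : i < M) : sigmaN (M + 2) i * AA M (i + 1) = AA M (i + 1) * AA M i := by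
  have h1 := (NC.sbr (M + 1)).at_tri1 (i := i) (j := i + 1) (l := M + 1) (by omega) (by omega) le_rfl
  rw [BrSeq.at_self] at h1
  exact h1

theorem AA_comm {i k : ℕ} (hi : i < M) (hk : k ≤ M) (h1 : k ≠ i) (h2 : k ≠ i + 1) :
    Commute (sigmaN (M + 2) i) (AA M k) := by
  rcases Nat.lt_or_ge k i with h | h
  · exact (NC.sbr (M + 1)).at_comm_in h (by omega) le_rfl
  · exact (BrSeq.comm_at (s := sigmaN (M + 2)) (by omega) fun p h3 h4 =>
      (show Commute _ _ from (sigmaN_comm (M + 2) i p (by omega)).symm)).symm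

theorem conj_aux {G : Type*} [Group G] {s a b : G} (h1 : s * b = a * s) (h2 : s * b = b * a) :
    s * b ^ 2 * s⁻¹ = a ^ 2 ∧ s * a ^ 2 * s⁻¹ = (a ^ 2)⁻¹ * b ^ 2 * a ^ 2 := by
  have e1 : s * b * s⁻¹ = a := by rw [h1]; group
  have e2 : s = a⁻¹ * b * a := by rw [mul_assoc, ← h2, h1]; group
  have e3 : a * b * a = b * a * b := by
    rw [mul_assoc, ← h2, ← mul_assoc, ← h1, h2]
  have e5 : b * a * b⁻¹ = a⁻¹ * b * a := by
    rw [mul_inv_eq_iff_eq_mul, mul_assoc, mul_assoc, eq_inv_mul_iff_mul_eq, ← mul_assoc,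
      ← mul_assoc, e3]
  have e4 : s * a * s⁻¹ = (a ^ 2)⁻¹ * b * a ^ 2 := by
    calc s * a * s⁻¹ = a⁻¹ * (b * a * b⁻¹) * a := by rw [e2]; group
      _ = _ := by rw [e5, sq]; group
  constructor
  · rw [← e1]; rw [sq, sq]; group
  · calc s * a ^ 2 * s⁻¹ = (s * a * s⁻¹) ^ 2 := by rw [sq, sq]; group
      _ = _ := by rw [e4, sq, sq, sq]; group

end Ann

open Equiv

namespace Ann

variable {M : ℕ}

/-- strand inclusion -/
def up (M : ℕ) : BraidGroup (M + 1) →* BraidGroup (M + 2) :=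
  braidLift (n := M + 1) (sigmaN (M + 2)) ((NC.sbr (M + 1)).mono (by omega))

theorem up_sigma {i : ℕ} (hi : i < M) : up M (sigmaN (M + 1) i) = sigmaN (M + 2) i :=
  braidLift_sigmaN (n := M + 1) _ _ i hi

theorem up_compat (g : BraidGroup (M + 1)) : ∀ f : F M,
    yl (fun i => AA M i ^ 2) (act M g f) = up M g * yl (fun i => AA M i ^ 2) f * (up M g)⁻¹ := by
  induction g using braid_induction with
  | hs i hi =>
    replace hi : i < M := hi
    intro f
    rw [act_sigma hi, up_sigma hi]
    have key : (yl (fun i => AA M i ^ 2)).comp (arA M i).toMonoidHom =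
      (MulAut.conj (sigmaN (M + 2) i)).toMonoidHom.comp (yl (fun i => AA M i ^ 2)) := by
      apply hom_ext
      intro k hk
      simp only [MonoidHom.comp_apply, MulEquiv.toMonoidHom_eq_coe, MonoidHom.coe_coe,
        MulAut.conj_apply]
      obtain ⟨c1, c2⟩ := conj_aux (AA_rel1 hi) ((AA_rel2 hi))
      rw [yl_y _ hk]
      by_cases h1 : k = i
      · subst h1
        rw [arA_self hi]
        simp only [map_mul, map_inv]
        rw [yl_y _ hk, yl_y _ (by omega), c2]
      by_cases h2 : k = i + 1
      · subst h2
        rw [arA_succ hi, yl_y _ (by omega), c1]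
      rw [arA_ne hi hk h1 h2, yl_y _ hk]
      have := (AA_comm hi hk h1 h2).pow_right 2
      rw [this.eq, mul_inv_cancel_right]
    exact DFunLike.congr_fun key f
  | h1 => intro f; simp
  | hm x y hx hy =>
    intro f
    simp only [map_mul, MulAut.mul_apply]
    rw [hx, hy]; group
  | hi x hx =>
    intro f
    have := hx ((act M x)⁻¹ f)
    simp only [MulAut.apply_inv_self] at this
    rw [this, map_inv, map_inv]; group

/-- the embedding of the annular braid group -/
def ph (M : ℕ) : K M →* BraidGroup (M + 2) :=
  SemidirectProduct.lift (yl (fun i => AA M i ^ 2)) (up M) (by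
    intro g; ext1 f; exact up_compat g _)

theorem ph_ky {k : ℕ} (hk : k ≤ M) : ph M (ky M k) = AA M k ^ 2 := by
  rw [ph, ky, SemidirectProduct.lift_inl, yl_y _ hk]

theorem ph_ks {k : ℕ} (hk : k < M) : ph M (ks M k) = sigmaN (M + 2) k := by
  rw [ph, ks, SemidirectProduct.lift_inr, up_sigma hk]

theorem ph_inr (b : BraidGroup (M + 1)) : ph M (SemidirectProduct.inr b) = up M b := by
  rw [ph, SemidirectProduct.lift_inr]

theorem tw_one (g : BraidGroup (M + 2)) (j : ℕ) (k : K M) :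
    tw M g (j, k) = ((tw M g (j, 1)).1, (tw M g (j, 1)).2 * k) := by
  conv_lhs => rw [← one_mul k]
  rw [tw_right]

theorem cocycle (g : BraidGroup (M + 2)) : ∀ (j : ℕ) (k : K M),
    (j ≤ M + 1 ↔ (tw M g (j, k)).1 ≤ M + 1) ∧ (j ≤ M + 1 →
      rr M (tw M g (j, k)).1 * ph M (tw M g (j, k)).2 = g * rr M j * ph M k) := by
  induction g using braid_induction with
  | hs i hi =>
    replace hi : i < M + 1 := hi
    intro j k
    rw [tw_sigma (by omega)]
    rcases Nat.lt_or_ge (M + 1) j with hj | hj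
    · rw [T_far hj (by omega)]
      exact ⟨Iff.rfl, fun h => by omega⟩
    rcases lt_trichotomy j i with h | rfl | h
    · obtain ⟨i, rfl⟩ : ∃ i', i = i' + 1 := ⟨i - 1, by omega⟩
      rw [T_lt (by omega) (by omega)]
      refine ⟨Iff.rfl, fun _ => ?_⟩
      rw [map_mul, ph_ks (by omega), rr_shift (by omega) (by omega), mul_assoc]
    · rw [T_self (by omega)]
      refine ⟨by simp only; omega, fun _ => ?_⟩
      rw [map_mul, ph_ky (by omega), rr_succ j, AA_eq, sq]
      group
    rcases lt_trichotomy j (i + 1) with h' | rfl | h'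
    · omega
    · rw [T_succ (by omega)]
      refine ⟨by simp only; omega, fun _ => ?_⟩
      rw [rr_succ]
    · rw [T_gt hj h']
      refine ⟨Iff.rfl, fun _ => ?_⟩
      rw [map_mul, ph_ks (by omega), rr_comm h' hj, mul_assoc]
  | h1 => intro j k; simp
  | hm x y hx hy =>
    intro j k
    simp only [map_mul, Perm.mul_apply]
    have h1 := hy j k
    have h2 := hx (tw M y (j, k)).1 (tw M y (j, k)).2
    simp only [Prod.mk.eta] at h2
    refine ⟨h1.1.trans h2.1, fun h => ?_⟩
    rw [h2.2 (h1.1.1 h), mul_assoc, h1.2 h]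
    group
  | hi x hx =>
    intro j k
    rw [map_inv]
    have h1 := hx ((tw M x)⁻¹ (j, k)).1 ((tw M x)⁻¹ (j, k)).2
    have e : tw M x ((tw M x)⁻¹ (j, k)) = (j, k) := Equiv.apply_symm_apply _ _
    simp only [Prod.mk.eta] at h1
    rw [e] at h1
    refine ⟨h1.1.symm, fun h => ?_⟩
    have := h1.2 (h1.1.2 h)
    rw [mul_assoc x⁻¹, this]; group

theorem eq_ph {g : BraidGroup (M + 2)} {κ : K M} (h : tw M g (M + 1, 1) = (M + 1, κ)) :
    g = ph M κ := by
  have := (cocycle g (M + 1) 1).2 le_rfl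
  rw [h, rr_top] at this
  simpa using this.symm

theorem tw_pow {g : BraidGroup (M + 2)} {κ : K M} (h : tw M g (M + 1, 1) = (M + 1, κ)) (q : ℕ) :
    tw M (g ^ q) (M + 1, 1) = (M + 1, κ ^ q) := by
  induction q with
  | zero => simp
  | succ q ih =>
    rw [pow_succ', map_mul, Perm.mul_apply, ih, tw_one, h, ← pow_succ']

/-- strand j is sent to strand M+1 -/
theorem tw_rr {j : ℕ} (hj : j ≤ M + 1) : tw M (rr M j) (M + 1, 1) = (j, 1) := by
  obtain ⟨d, hd⟩ : ∃ d, j + d = M + 1 := ⟨M + 1 - j, by omega⟩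
  induction d generalizing j with
  | zero =>
    obtain rfl : j = M + 1 := by omega
    rw [rr_top]; simp
  | succ d ih =>
    rw [rr_succ, map_mul, Perm.mul_apply, ih (by omega) (by omega), tw_sigma (by omega),
      T_succ (by omega)]

theorem tw_conj {g : BraidGroup (M + 2)} {j : ℕ} (hj : j ≤ M + 1) (h : (tw M g (j, 1)).1 = j) :
    ∃ κ, tw M ((rr M j)⁻¹ * g * rr M j) (M + 1, 1) = (M + 1, κ) := by
  refine ⟨(tw M g (j, 1)).2, ?_⟩
  have h2 := tw_rr hj
  have h3 : tw M g (j, 1) = (j, (tw M g (j, 1)).2) := Prod.ext h rfl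
  rw [map_mul, map_mul, Perm.mul_apply, Perm.mul_apply, h2, map_inv, Perm.inv_eq_iff_eq,
    tw_one (rr M j), h2]
  simpa using h3

end Ann

namespace Ann

section FG
variable {α : Type*} [DecidableEq α]

/-- twisted norm partial products -/
def NN (p : Equiv.Perm α) (f : FreeGroup α) : ℕ → FreeGroup α
  | 0 => 1
  | k + 1 => f * FreeGroup.map p (NN p f k)

/-- word version -/
def WW (p : Equiv.Perm α) (w : List (α × Bool)) : ℕ → List (α × Bool)
  | 0 => []
  | k + 1 => w ++ (WW p w k).map (fun x => (p x.1, x.2))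

theorem NN_mk (p : Equiv.Perm α) (w : List (α × Bool)) (k : ℕ) :
    NN p (FreeGroup.mk w) k = FreeGroup.mk (WW p w k) := by
  induction k with
  | zero => rfl
  | succ k ih => rw [NN, ih, WW, FreeGroup.map.mk, FreeGroup.mul_mk]

theorem WW_reduced (p : Equiv.Perm α) (w : List (α × Bool)) (h : FreeGroup.IsReduced w)
    (hw : w ≠ []) (h2 : ∀ a ∈ w.getLast?, ∀ b ∈ w.head?, a.1 = p b.1 → a.2 = b.2) (k : ℕ) :
    FreeGroup.IsReduced (WW p w k) ∧ (∀ b ∈ (WW p w k).head?, b ∈ w.head?) := by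
  induction k with
  | zero => simp [WW]
  | succ k ih =>
    constructor
    · rw [WW, FreeGroup.IsReduced, List.isChain_append]
      refine ⟨h, ?_, ?_⟩
      · rw [List.isChain_map]
        refine ih.1.imp ?_
        intro a b hab e
        exact hab (p.injective e)
      · intro a ha b hb
        rw [List.head?_map] at hb
        simp only [Option.mem_def, Option.map_eq_some_iff] at hb
        obtain ⟨c, hc, rfl⟩ := hb
        exact h2 a ha c (ih.2 c hc)
    · intro b hb
      rw [WW, List.head?_append_of_ne_nil _ hw] at hb
      exact hb

theorem NN_conj (p : Equiv.Perm α) (f x : FreeGroup α) (k : ℕ) :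
    NN p (x * f * (FreeGroup.map p x)⁻¹) k =
      x * NN p f k * (FreeGroup.map (p ^ k : Equiv.Perm α) x)⁻¹ := by
  induction k with
  | zero =>
    have : FreeGroup.map ((p ^ 0 : Equiv.Perm α)) x = x := by
      rw [pow_zero]; exact FreeGroup.map.id x
    rw [NN, NN, this]; simp
  | succ k ih =>
    have : FreeGroup.map p (FreeGroup.map (p ^ k : Equiv.Perm α) x) =
        FreeGroup.map (p ^ (k + 1) : Equiv.Perm α) x := by
      rw [FreeGroup.map.comp, pow_succ']; rfl
    rw [NN, NN, ih, map_mul, map_mul, map_inv, this]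
    group

theorem fg_h1 (p : Equiv.Perm α) (q : ℕ) (hq : 0 < q) (hp : p ^ q = 1) : ∀ (n : ℕ)
    (f : FreeGroup α), f.toWord.length ≤ n → NN p f q = 1 → ∃ h, f = h * (FreeGroup.map p h)⁻¹ := by
  intro n
  induction n with
  | zero =>
    intro f hf _
    refine ⟨1, ?_⟩
    have : f.toWord = [] := by simpa using hf
    rw [FreeGroup.toWord_eq_nil_iff] at this
    simp [this]
  | succ n ih =>
    intro f hf hN
    rcases hw : f.toWord with _ | ⟨x, w⟩
    · rw [FreeGroup.toWord_eq_nil_iff] at hw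
      exact ⟨1, by simp [hw]⟩
    have hf2 : f = FreeGroup.mk (x :: w) := by rw [← hw, FreeGroup.mk_toWord]
    have hr : FreeGroup.IsReduced (x :: w) := hw ▸ FreeGroup.isReduced_toWord
    by_cases h2 : ∀ a ∈ (x :: w).getLast?, ∀ b ∈ (x :: w).head?, a.1 = p b.1 → a.2 = b.2
    · exfalso
      have h3 := (WW_reduced p (x :: w) hr (by simp) h2 q).1
      rw [hf2, NN_mk] at hN
      have h4 := congrArg FreeGroup.toWord hN
      rw [FreeGroup.toWord_mk, h3.reduce_eq] at h4
      obtain ⟨q, rfl⟩ : ∃ q', q = q' + 1 := ⟨q - 1, by omega⟩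
      simp [WW] at h4
    · push Not at h2
      obtain ⟨a, ha, b, hb, e1, e2⟩ := h2
      obtain rfl : x = b := by simpa using hb
      rcases List.eq_nil_or_concat' w with rfl | ⟨mid, c, rfl⟩
      · obtain rfl : x = a := by simpa using ha
        exact absurd rfl e2
      obtain rfl : c = a := by
        rw [← List.cons_append, List.getLast?_concat] at ha
        simpa using ha
      have e3 : c = (p x.1, !x.2) := by
        rcases c with ⟨c1, c2⟩
        rcases x with ⟨x1, x2⟩
        simp only at e1 e2
        subst e1
        cases c2 <;> cases x2 <;> simp_all
      have hx : f = FreeGroup.mk [x] * FreeGroup.mk mid * (FreeGroup.map p (FreeGroup.mk [x]))⁻¹ := by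
        rw [FreeGroup.map.mk, FreeGroup.inv_mk, FreeGroup.mul_mk, FreeGroup.mul_mk, hf2, e3]
        simp [FreeGroup.invRev]
      have hN' : NN p (FreeGroup.mk mid) q = 1 := by
        rw [hx, NN_conj, hp] at hN
        have : FreeGroup.map ((1 : Equiv.Perm α)) (FreeGroup.mk [x]) = FreeGroup.mk [x] :=
          FreeGroup.map.id _
        rw [this] at hN
        rwa [mul_inv_eq_one, mul_eq_left] at hN
      obtain ⟨h, hh⟩ := ih (FreeGroup.mk mid) (by
        have h5 : (FreeGroup.mk mid).toWord.length ≤ mid.length := FreeGroup.norm_mk_le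
        rw [hw] at hf
        simp at hf
        omega) hN'
      refine ⟨FreeGroup.mk [x] * h, ?_⟩
      rw [hx, hh, map_mul]
      group

end FG

end Ann

open Equiv

namespace Ann

variable {M : ℕ}

/-- the generator of rotation -/
def E (M : ℕ) : K M := SemidirectProduct.inr (deltaBraid (M + 1)) * ky M M

theorem inr_delta : (SemidirectProduct.inr (deltaBraid (M + 1)) : K M) = BrSeq.dd (ks M) M := by
  rw [deltaBraid_eq]
  exact BrSeq.map_dd _ _ _

theorem up_delta : up M (deltaBraid (M + 1)) = BrSeq.dd (sigmaN (M + 2)) M := by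
  rw [deltaBraid_eq]
  refine (BrSeq.map_dd _ _ _).trans (BrSeq.dd_congr _ fun i hi => up_sigma hi)

theorem ph_E : ph M (E M) = deltaBraid (M + 2) * sigmaN (M + 2) M := by
  rw [E, map_mul, ph_inr, up_delta, ph_ky le_rfl, AA, BrSeq.at_self, deltaBraid_eq (M + 2), sq,
    ← mul_assoc]
  rfl

theorem tw_dd {k : ℕ} (hk : k ≤ M) (x : K M) :
    tw M (BrSeq.dd (sigmaN (M + 2)) k) (M + 1, x) = (M + 1, BrSeq.dd (ks M) k * x) := by
  induction k generalizing x with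
  | zero => simp [BrSeq.dd]
  | succ k ih =>
    rw [BrSeq.dd, BrSeq.dd, map_mul, Perm.mul_apply, tw_sigma (by omega),
      T_gt (by omega) (by omega), ih (by omega), mul_assoc]

theorem tw_E : tw M (deltaBraid (M + 2) * sigmaN (M + 2) M) (M + 1, 1) = (M + 1, E M) := by
  have h : deltaBraid (M + 2) = BrSeq.dd (sigmaN (M + 2)) M * sigmaN (M + 2) M := by
    rw [deltaBraid_eq (M + 2)]; rfl
  rw [h, map_mul, map_mul, Perm.mul_apply, Perm.mul_apply, tw_sigma le_rfl, T_succ le_rfl,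
    T_self le_rfl, tw_dd le_rfl, E, inr_delta, mul_one]

theorem delta_pow_sigma {j : ℕ} (hj : j ≤ M) :
    deltaBraid (M + 2) ^ j * sigmaN (M + 2) 0 = sigmaN (M + 2) j * deltaBraid (M + 2) ^ j := by
  induction j with
  | zero => simp
  | succ j ih =>
    have h := (NC.sbr (M + 1)).dd_shift (k := M + 1) (i := j) (by omega) le_rfl
    have h' : deltaBraid (M + 2) * sigmaN (M + 2) j = sigmaN (M + 2) (j + 1) * deltaBraid (M + 2) := by
      rw [deltaBraid_eq (M + 2)]; exact h
    rw [pow_succ', mul_assoc, ih (by omega), ← mul_assoc, h', mul_assoc]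

theorem E_conj : deltaBraid (M + 2) * sigmaN (M + 2) M =
    deltaBraid (M + 2) ^ (M + 1) * epsBraid (M + 2) * (deltaBraid (M + 2) ^ (M + 1))⁻¹ := by
  rw [eq_mul_inv_iff_mul_eq, epsBraid, pow_succ', mul_assoc, mul_assoc, ← mul_assoc _ (sigmaN _ 0),
    delta_pow_sigma le_rfl, mul_assoc, ← pow_succ, ← pow_succ']

theorem E_pow : (deltaBraid (M + 2) * sigmaN (M + 2) M) ^ (M + 1) = zBraid (M + 2) := by
  rw [E_conj, conj_pow]
  have : epsBraid (M + 2) ^ (M + 1) = zBraid (M + 2) := eps_pow_z (M + 2)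
  rw [this, ← ((zBraid_comm (M + 2)) _).eq]
  group

theorem kap_pow {β : BraidGroup (M + 2)} {κ : K M} {q : ℕ} (hb : β ^ q = zBraid (M + 2))
    (h : tw M β (M + 1, 1) = (M + 1, κ)) : κ ^ q = E M ^ (M + 1) := by
  have h1 := tw_pow h q
  have h2 := tw_pow (tw_E (M := M)) (M + 1)
  rw [hb, ← E_pow, h2] at h1
  exact (Prod.ext_iff.1 h1).2.symm

theorem act_dd {k : ℕ} (hk : k ≤ M) : (∀ j < k, BrSeq.dd (arA M) k (y M j) =
    (y M 0)⁻¹ * y M (j + 1) * y M 0) ∧ BrSeq.dd (arA M) k (y M k) = y M 0 ∧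
    ∀ j, k < j → j ≤ M → BrSeq.dd (arA M) k (y M j) = y M j := by
  induction k with
  | zero => simp [BrSeq.dd]
  | succ k ih =>
    obtain ⟨i1, i2, i3⟩ := ih (by omega)
    refine ⟨?_, ?_, ?_⟩
    · intro j hj
      rw [BrSeq.dd, MulAut.mul_apply]
      rcases Nat.lt_or_ge j k with h | h
      · rw [arA_ne (by omega) (by omega) (by omega) (by omega), i1 j h]
      · obtain rfl : j = k := by omega
        rw [arA_self (by omega)]
        simp only [map_mul, map_inv]
        rw [i2, i3 (j + 1) (by omega) (by omega)]
    · rw [BrSeq.dd, MulAut.mul_apply, arA_succ (by omega), i2]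
    · intro j h1 h2
      rw [BrSeq.dd, MulAut.mul_apply, arA_ne (by omega) (by omega) (by omega) (by omega),
        i3 j (by omega) h2]

theorem act_delta : act M (deltaBraid (M + 1)) = BrSeq.dd (arA M) M := by
  rw [deltaBraid_eq]
  exact (BrSeq.map_dd _ _ _).trans (BrSeq.dd_congr _ fun i hi => act_sigma hi)

theorem rot_y {j : ℕ} (hj : j ≤ M) : FreeGroup.map (finRotate (M + 1)) (y M j) =
    if j = M then y M 0 else y M (j + 1) := by
  split_ifs with h
  · subst h
    rw [y, y, dif_pos (by omega), dif_pos (by omega), FreeGroup.map.of]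
    congr 1
    exact finRotate_last
  · rw [y, y, dif_pos (by omega), dif_pos (by omega), FreeGroup.map.of]
    congr 1
    exact finRotate_of_lt (by omega)

theorem E_inl (f : F M) : E M * (SemidirectProduct.inl f : K M) =
    SemidirectProduct.inl (FreeGroup.map (finRotate (M + 1)) f) * E M := by
  have key : (act M (deltaBraid (M + 1))).toMonoidHom.comp (MulAut.conj (y M M)).toMonoidHom =
      FreeGroup.map (finRotate (M + 1)) := by
    apply hom_ext
    intro k hk
    obtain ⟨i1, i2, i3⟩ := act_dd (le_refl M)
    rw [rot_y hk]
    simp only [MonoidHom.comp_apply, MulEquiv.toMonoidHom_eq_coe, MonoidHom.coe_coe,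
        MulAut.conj_apply]
    rw [act_delta]
    simp only [map_mul, map_inv]
    rw [i2]
    split_ifs with h
    · rw [h, i2]; group
    · rw [i1 k (by omega)]; group
  have k2 := DFunLike.congr_fun key f
  simp only [MonoidHom.comp_apply, MulEquiv.toMonoidHom_eq_coe, MonoidHom.coe_coe,
        MulAut.conj_apply] at k2
  rw [← k2]
  simp only [E, ky]
  ext <;> simp [mul_assoc]

theorem E_pow_inl (c : ℕ) (f : F M) : E M ^ c * (SemidirectProduct.inl f : K M) =
    SemidirectProduct.inl (FreeGroup.map (finRotate (M + 1) ^ c : Perm _) f) * E M ^ c := by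
  induction c generalizing f with
  | zero =>
    have : FreeGroup.map ((finRotate (M + 1) ^ 0 : Perm _)) f = f := by
      rw [pow_zero]; exact FreeGroup.map.id f
    rw [this]; simp
  | succ c ih =>
    have : FreeGroup.map (finRotate (M + 1) ^ c : Perm _) (FreeGroup.map (finRotate (M + 1)) f) =
        FreeGroup.map (finRotate (M + 1) ^ (c + 1) : Perm _) f := by
      rw [FreeGroup.map.comp, pow_succ]; rfl
    rw [pow_succ, mul_assoc, E_inl, ← mul_assoc, ih, this, mul_assoc]

theorem NN_pow (c : ℕ) (f : F M) (k : ℕ) : ((SemidirectProduct.inl f : K M) * E M ^ c) ^ k =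
    SemidirectProduct.inl (NN (finRotate (M + 1) ^ c) f k) * E M ^ (c * k) := by
  induction k with
  | zero => simp [NN]
  | succ k ih =>
    rw [pow_succ', ih, NN, map_mul, mul_assoc, ← mul_assoc (E M ^ c), E_pow_inl, mul_assoc,
      ← pow_add, mul_assoc, mul_add, mul_one, add_comm c]

theorem E_right : (E M).right = deltaBraid (M + 1) := by simp [E, ky]

/-- exponent sum in the free part -/
def es (M : ℕ) : K M →* Multiplicative ℤ :=
  SemidirectProduct.lift (yl fun _ => Multiplicative.ofAdd 1) 1 (by
    intro g
    induction g using braid_induction with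
    | hs i hi =>
      replace hi : i < M := hi
      apply hom_ext
      intro k hk
      simp only [MonoidHom.comp_apply, MulEquiv.toMonoidHom_eq_coe, MonoidHom.coe_coe,
        MulAut.conj_apply, MonoidHom.one_apply, one_mul, inv_one, mul_one]
      rw [act_sigma hi, yl_y _ hk]
      by_cases h1 : k = i
      · subst h1
        rw [arA_self hi]
        simp only [map_mul, map_inv]
        rw [yl_y _ hk, yl_y _ (by omega)]
        simp
      by_cases h2 : k = i + 1
      · subst h2
        rw [arA_succ hi, yl_y _ (by omega)]
      rw [arA_ne hi hk h1 h2, yl_y _ hk]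
    | h1 => ext; simp
    | hm x y hx hy =>
      ext1 a
      have h1 := DFunLike.congr_fun hx (act M y (FreeGroup.of a))
      have h2 := DFunLike.congr_fun hy (FreeGroup.of a)
      simp at h1 h2 ⊢
      rw [h1, h2]
    | hi x hx =>
      ext1 a
      have h1 := DFunLike.congr_fun hx ((act M x)⁻¹ (FreeGroup.of a))
      simp at h1 ⊢
      rw [h1])

theorem es_E : es M (E M) = Multiplicative.ofAdd 1 := by
  rw [E, map_mul, es, SemidirectProduct.lift_inr, ky, SemidirectProduct.lift_inl, yl_y _ le_rfl]
  simp

theorem tw_mul {g h : BraidGroup (M + 2)} {κ l : K M} (h1 : tw M g (M + 1, 1) = (M + 1, κ))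
    (h2 : tw M h (M + 1, 1) = (M + 1, l)) : tw M (g * h) (M + 1, 1) = (M + 1, κ * l) := by
  rw [map_mul, Perm.mul_apply, h2, tw_one, h1]

theorem tw_up (b : BraidGroup (M + 1)) :
    tw M (up M b) (M + 1, 1) = (M + 1, SemidirectProduct.inr b) := by
  induction b using braid_induction with
  | hs i hi =>
    replace hi : i < M := hi
    rw [up_sigma hi, tw_sigma hi.le, T_gt le_rfl (by omega), mul_one, ks]
  | h1 => simp
  | hm x y hx hy =>
    rw [map_mul (up M), map_mul (SemidirectProduct.inr)]
    exact tw_mul hx hy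
  | hi x hx =>
    rw [map_inv, map_inv, Perm.inv_eq_iff_eq, tw_one, hx]
    simp

theorem kap_conj {κ : K M} {q : ℕ} (hq : 0 < q) (h : κ ^ q = E M ^ (M + 1)) :
    ∃ (c : ℕ) (g : K M), κ * g = g * E M ^ c := by
  obtain ⟨c, hc⟩ : ∃ c : ℕ, M + 1 = c * q := by
    have h1 := congrArg (fun x => Multiplicative.toAdd (es M x)) h
    simp only [map_pow, es_E, toAdd_pow, toAdd_ofAdd, nsmul_eq_mul, mul_one] at h1
    have h2 : (q : ℤ) ∣ ((M + 1 : ℕ) : ℤ) := ⟨_, h1.symm⟩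
    obtain ⟨c, hc⟩ := Int.natCast_dvd_natCast.1 h2
    exact ⟨c, by rw [hc, mul_comm]⟩
  have hr : κ.right ^ q = zBraid (M + 1) := by
    have := congrArg SemidirectProduct.rightHom h
    simp only [map_pow, SemidirectProduct.rightHom_eq_right] at this
    rw [E_right] at this
    exact this
  obtain ⟨b, hb⟩ := NC.delta_case κ.right q c hq hc hr
  -- conjugate by inr b
  set B : K M := SemidirectProduct.inr b with hB
  set κ' : K M := B⁻¹ * κ * B with hκ'
  have h1 : (κ' * (E M ^ c)⁻¹).right = 1 := by
    have hE : (E M ^ c).right = deltaBraid (M + 1) ^ c := by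
      have := map_pow (SemidirectProduct.rightHom (φ := act M)) (E M) c
      simpa only [SemidirectProduct.rightHom_eq_right, E_right] using this
    rw [hκ', SemidirectProduct.mul_right, SemidirectProduct.mul_right, SemidirectProduct.mul_right,
      SemidirectProduct.inv_right, SemidirectProduct.inv_right, hE, hB,
      SemidirectProduct.right_inr, mul_assoc b⁻¹, hb]
    group
  obtain ⟨f, hf⟩ : ∃ f : F M, κ' = SemidirectProduct.inl f * E M ^ c := by
    refine ⟨(κ' * (E M ^ c)⁻¹).left, ?_⟩
    rw [← mul_inv_eq_iff_eq_mul]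
    ext
    · simp
    · rw [h1]; simp
  have h2 : κ' ^ q = E M ^ (M + 1) := by
    have hz : Commute (E M ^ (M + 1)) B := by
      have e1 := tw_up b
      have e2 := tw_pow (tw_E (M := M)) (M + 1)
      rw [E_pow] at e2
      have e3 := tw_mul e1 e2
      have e4 := tw_mul e2 e1
      rw [((zBraid_comm (M + 2)) _).eq, e3] at e4
      exact (Prod.ext_iff.1 e4).2.symm
    have e : κ' ^ q = B⁻¹ * κ ^ q * B := by
      rw [hκ']; simpa using (conj_pow (a := B⁻¹) (b := κ) (i := q))
    rw [e, h, mul_assoc, hz.eq]; group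
  have hc' : E M ^ (M + 1) = E M ^ (c * q) := congrArg _ hc
  rw [hf, NN_pow, hc'] at h2
  have h3 : NN (finRotate (M + 1) ^ c) f q = 1 := by
    apply SemidirectProduct.inl_injective (φ := act M)
    rw [map_one]
    exact mul_eq_right.1 h2
  obtain ⟨x, hx⟩ := fg_h1 (finRotate (M + 1) ^ c) q hq
    (by rw [← pow_mul, ← hc, NC.rot_pow]) _ f le_rfl h3
  refine ⟨c, B * SemidirectProduct.inl x, ?_⟩
  have h4 : κ * B = B * κ' := by rw [hκ']; group
  rw [← mul_assoc, h4, hf, mul_assoc, mul_assoc, E_pow_inl, ← mul_assoc _ _ (E M ^ c), ← map_mul,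
    hx, mul_assoc]
  simp [mul_assoc]

theorem eps_case {β : BraidGroup (M + 2)} {q : ℕ} (hq : 0 < q) (hb : β ^ q = zBraid (M + 2))
    {j : ℕ} (hj : j ≤ M + 1) (hfix : (tw M β (j, 1)).1 = j) :
    ∃ (c : ℕ) (g : BraidGroup (M + 2)), β * g = g * epsBraid (M + 2) ^ c := by
  obtain ⟨κ, hκ⟩ := tw_conj hj hfix
  have hb2 : ((rr M j)⁻¹ * β * rr M j) ^ q = zBraid (M + 2) := by
    have := conj_pow (a := (rr M j)⁻¹) (b := β) (i := q)
    rw [inv_inv] at this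
    rw [this, hb, mul_assoc, ((zBraid_comm (M + 2)) _).eq]
    group
  obtain ⟨c, g, hg⟩ := kap_conj hq (kap_pow hb2 hκ)
  have h1 := congrArg (ph M) hg
  rw [map_mul, map_mul, map_pow, ph_E, ← eq_ph hκ, E_conj, conj_pow] at h1
  refine ⟨c, rr M j * ph M g * deltaBraid (M + 2) ^ (M + 1), ?_⟩
  have h2 : β * (rr M j * ph M g) = rr M j * ((rr M j)⁻¹ * β * rr M j * ph M g) := by group
  rw [← mul_assoc, h2, h1]
  group

end Ann

open Equiv

namespace Lk

variable {M : ℕ}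

/-- strand permutation generators form a braid sequence -/
theorem swap_brSeq (N : ℕ) : BrSeq N (fun i => (swap i (i + 1) : Perm ℕ)) := by
  constructor
  · intro i j hij _
    exact (Perm.Disjoint.commute (by
      intro x
      by_cases h : x = i ∨ x = i + 1
      · right; exact swap_apply_of_ne_of_ne (by omega) (by omega)
      · left; exact swap_apply_of_ne_of_ne (by omega) (by omega))).eq
  · intro i _
    ext x
    simp only [Perm.mul_apply, swap_apply_def]
    split_ifs <;> omega

/-- strand permutation -/
def pi (n : ℕ) : BraidGroup n →* Perm ℕ := braidLift _ (swap_brSeq (n - 1))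

theorem pi_sigma {i : ℕ} (hi : i ≤ M) : pi (M + 2) (sigmaN (M + 2) i) = swap i (i + 1) :=
  braidLift_sigmaN (n := M + 2) _ _ i (by omega)

theorem tw_fst (g : BraidGroup (M + 2)) : ∀ (x : ℕ × Ann.K M),
    (Ann.tw M g x).1 = pi (M + 2) g x.1 := by
  induction g using braid_induction with
  | hs i hi =>
    intro x
    rw [Ann.tw_sigma (by omega), pi_sigma (by omega)]
    rfl
  | h1 => intro x; simp
  | hm x y hx hy =>
    intro a
    rw [map_mul, map_mul, Perm.mul_apply, Perm.mul_apply, hx, hy]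
  | hi x hx =>
    intro a
    have := hx ((Ann.tw M x)⁻¹ a)
    have e : Ann.tw M x ((Ann.tw M x)⁻¹ a) = a := Equiv.apply_symm_apply _ _
    rw [e] at this
    rw [map_inv, map_inv, Perm.eq_inv_iff_eq, this]

theorem pi_le (g : BraidGroup (M + 2)) (j : ℕ) : pi (M + 2) g j < M + 2 ↔ j < M + 2 := by
  have h := (Ann.cocycle g j 1).1
  rw [tw_fst] at h
  simp only at h
  omega

/-- linking generators -/
def lg (i : ℕ) : Perm ((ℕ × ℕ) × ℤ) :=
  Equiv.prodShear (Equiv.prodCongr (swap i (i + 1)) (swap i (i + 1)))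
    (fun ab => Equiv.addRight (if ab.1 = i ∧ ab.2 = i + 1 then 1 else 0))

theorem lg_apply (i a b : ℕ) (k : ℤ) : lg i ((a, b), k) =
    ((swap i (i + 1) a, swap i (i + 1) b), k + if a = i ∧ b = i + 1 then 1 else 0) := rfl

theorem lg_brSeq (N : ℕ) : BrSeq N lg := by
  have hs := swap_brSeq N
  constructor
  · intro i j hij hj
    have h := hs.comm i j hij hj
    ext1 ⟨⟨a, b⟩, k⟩
    have h1 := DFunLike.congr_fun h a
    have h2 := DFunLike.congr_fun h b
    simp only [Perm.mul_apply] at h1 h2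
    simp only [Perm.mul_apply, lg_apply, h1, h2]
    congr 1
    have e1 : swap i (i + 1) j = j := swap_apply_of_ne_of_ne (by omega) (by omega)
    have e2 : swap i (i + 1) (j + 1) = j + 1 := swap_apply_of_ne_of_ne (by omega) (by omega)
    have e3 : swap j (j + 1) i = i := swap_apply_of_ne_of_ne (by omega) (by omega)
    have e4 : swap j (j + 1) (i + 1) = i + 1 := swap_apply_of_ne_of_ne (by omega) (by omega)
    simp only [swap_apply_eq_iff, e1, e2, e3, e4]
    rw [add_right_comm]
  · intro i hi
    have h := hs.braid i hi
    ext1 ⟨⟨a, b⟩, k⟩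
    have h1 := DFunLike.congr_fun h a
    have h2 := DFunLike.congr_fun h b
    simp only [Perm.mul_apply] at h1 h2
    simp only [Perm.mul_apply, lg_apply, h1, h2]
    congr 1
    have e1 : swap i (i + 1) i = i + 1 := swap_apply_left _ _
    have e2 : swap i (i + 1) (i + 1) = i := swap_apply_right _ _
    have e3 : swap i (i + 1) (i + 1 + 1) = i + 1 + 1 :=
      swap_apply_of_ne_of_ne (by omega) (by omega)
    have e4 : swap (i + 1) (i + 1 + 1) i = i := swap_apply_of_ne_of_ne (by omega) (by omega)
    have e5 : swap (i + 1) (i + 1 + 1) (i + 1) = i + 1 + 1 := swap_apply_left _ _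
    have e6 : swap (i + 1) (i + 1 + 1) (i + 1 + 1) = i + 1 := swap_apply_right _ _
    simp only [swap_apply_eq_iff, e1, e2, e3, e4, e5, e6]
    ring

/-- linking action -/
def lk (n : ℕ) : BraidGroup n →* Perm ((ℕ × ℕ) × ℤ) := braidLift lg (lg_brSeq (n - 1))

theorem lk_sigma {i : ℕ} (hi : i ≤ M) : lk (M + 2) (sigmaN (M + 2) i) = lg i :=
  braidLift_sigmaN (n := M + 2) _ _ i (by omega)

theorem lk_eq (g : BraidGroup (M + 2)) : ∀ (a b : ℕ), ∃ l : ℤ, ∀ k,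
    lk (M + 2) g ((a, b), k) = ((pi (M + 2) g a, pi (M + 2) g b), k + l) := by
  induction g using braid_induction with
  | hs i hi =>
    intro a b
    rw [lk_sigma (by omega), pi_sigma (by omega)]
    exact ⟨_, fun k => lg_apply i a b k⟩
  | h1 => intro a b; exact ⟨0, by simp⟩
  | hm x y hx hy =>
    intro a b
    obtain ⟨l1, h1⟩ := hy a b
    obtain ⟨l2, h2⟩ := hx (pi (M + 2) y a) (pi (M + 2) y b)
    refine ⟨l1 + l2, fun k => ?_⟩
    simp only [map_mul, Perm.mul_apply]
    rw [h1, h2, add_assoc]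
  | hi x hx =>
    intro a b
    obtain ⟨l, h⟩ := hx ((pi (M + 2) x)⁻¹ a) ((pi (M + 2) x)⁻¹ b)
    refine ⟨-l, fun k => ?_⟩
    rw [map_inv, map_inv, Perm.inv_eq_iff_eq, h]
    simp

theorem lk_dd {k : ℕ} (hk : k ≤ M + 1) (a b : ℕ) (x : ℤ) :
    lk (M + 2) (BrSeq.dd (sigmaN (M + 2)) k) ((a, b), x) =
    ((if a < k then a + 1 else if a = k then 0 else a,
      if b < k then b + 1 else if b = k then 0 else b),
      x + if b = k ∧ a < k then 1 else 0) := by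
  induction k generalizing a b x with
  | zero => 
    simp only [BrSeq.dd, map_one, Perm.one_apply]
    congr 1
    · congr 1 <;> (split_ifs <;> omega)
    · simp
  | succ k ih =>
    rw [BrSeq.dd, map_mul, Perm.mul_apply, lk_sigma (by omega), lg_apply, ih (by omega)]
    simp only [swap_apply_def]
    congr 1
    · congr 1 <;> (split_ifs <;> omega)
    · split_ifs <;> omega

theorem lk_delta_pow {a b : ℕ} (ha : a < M + 2) (hb : b < M + 2) (hab : a ≠ b) (x : ℤ) {j : ℕ}
    (hj : j ≤ M + 2) : lk (M + 2) (deltaBraid (M + 2) ^ j) ((a, b), x) =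
    ((if a + j < M + 2 then a + j else a + j - (M + 2),
      if b + j < M + 2 then b + j else b + j - (M + 2)),
      x + if b + j < M + 2 then 0 else 1) := by
  induction j with
  | zero => simp [ha, hb]
  | succ j ih =>
    rw [pow_succ', map_mul, Perm.mul_apply, ih (by omega), deltaBraid_eq]
    refine (lk_dd le_rfl _ _ _).trans ?_
    congr 1
    · congr 1 <;> (split_ifs <;> omega)
    · split_ifs <;> omega

theorem lk_z {a b : ℕ} (ha : a < M + 2) (hb : b < M + 2) (hab : a ≠ b) (x : ℤ) :
    lk (M + 2) (zBraid (M + 2)) ((a, b), x) = ((a, b), x + 1) := by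
  refine (lk_delta_pow ha hb hab x le_rfl).trans ?_
  simp

theorem lk_z_pow {a b : ℕ} (ha : a < M + 2) (hb : b < M + 2) (hab : a ≠ b) (d : ℕ) (x : ℤ) :
    lk (M + 2) (zBraid (M + 2) ^ d) ((a, b), x) = ((a, b), x + d) := by
  induction d with
  | zero => simp
  | succ d ih =>
    rw [pow_succ', map_mul, Perm.mul_apply, ih, lk_z ha hb hab]
    push_cast
    rw [add_assoc]

theorem pi_z {a : ℕ} (ha : a < M + 2) : pi (M + 2) (zBraid (M + 2)) a = a := by
  obtain ⟨b, hb, hab⟩ : ∃ b < M + 2, a ≠ b := by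
    by_cases h : a = 0
    · exact ⟨1, by omega, by omega⟩
    · exact ⟨0, by omega, by omega⟩
  obtain ⟨l, hl⟩ := lk_eq (zBraid (M + 2)) a b
  have h2 := hl 0
  rw [lk_z ha hb hab] at h2
  exact (Prod.ext_iff.1 (Prod.ext_iff.1 h2).1).1.symm

theorem no_fix {β : BraidGroup (M + 2)} {q d : ℕ} (hb : β ^ q = zBraid (M + 2)) (hd : 0 < d)
    (hdq : d < q) {a : ℕ} (ha : a < M + 2) (h1 : pi (M + 2) β a ≠ a)
    (h2 : ((pi (M + 2) β) ^ d) a = a) : False := by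
  set b := pi (M + 2) β a with hbd
  have hb' : b < M + 2 := (pi_le β a).2 ha
  have h3 : ((pi (M + 2) β) ^ d) b = b := by
    rw [hbd, ← Perm.mul_apply, ← pow_succ, pow_succ', Perm.mul_apply, h2]
  obtain ⟨l, hl⟩ := lk_eq (β ^ d) a b
  rw [map_pow (pi (M + 2)), h2, h3] at hl
  have h4 : ∀ r : ℕ, lk (M + 2) ((β ^ d) ^ r) ((a, b), 0) = ((a, b), r * l) := by
    intro r
    induction r with
    | zero => simp
    | succ r ih =>
      rw [pow_succ', map_mul, Perm.mul_apply, ih, hl]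
      push_cast
      rw [add_mul, one_mul]
  have h5 := h4 q
  rw [← pow_mul, mul_comm d q, pow_mul, hb, lk_z_pow ha hb' (Ne.symm h1)] at h5
  have h6 := (Prod.ext_iff.1 h5).2
  simp only [zero_add] at h6
  have h7 : (q : ℤ) ∣ (d : ℤ) := ⟨l, h6⟩
  have h8 := Nat.le_of_dvd hd (Int.natCast_dvd_natCast.1 h7)
  omega

theorem dvd_n {β : BraidGroup (M + 2)} {q : ℕ} (hq : 0 < q) (hb : β ^ q = zBraid (M + 2))
    (hfix : ∀ a < M + 2, pi (M + 2) β a ≠ a) : q ∣ M + 2 := by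
  let p : Perm {j : ℕ // j < M + 2} := (pi (M + 2) β).subtypePerm (pi_le β)
  have hp : ∀ (d : ℕ) (a : {j : ℕ // j < M + 2}), ((p ^ d) a).val = ((pi (M + 2) β) ^ d) a.val := by
    intro d a
    rw [Perm.subtypePerm_pow]; rfl
  have hpq : p ^ q = 1 := by
    ext a
    rw [hp, ← map_pow, hb, pi_z a.2]; rfl
  have hnf : ∀ d, 0 < d → d < q → ∀ a, (p ^ d) a ≠ a := by
    intro d h1 h2 a h3
    refine no_fix hb h1 h2 a.2 (hfix _ a.2) ?_
    rw [← hp, h3]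
  have ho : orderOf p = q := by
    have h1 : 0 < orderOf p := orderOf_pos_iff.2 (isOfFinOrder_iff_pow_eq_one.2 ⟨q, hq, hpq⟩)
    rcases Nat.lt_or_ge (orderOf p) q with h | h
    · exact absurd (by rw [pow_orderOf_eq_one]; rfl) (hnf _ h1 h ⟨0, by omega⟩)
    · exact le_antisymm (orderOf_le_of_pow_eq_one hq hpq) h
  have hst : ∀ a : {j : ℕ // j < M + 2}, MulAction.stabilizer (Subgroup.zpowers p) a = ⊥ := by
    intro a
    classical
    rw [eq_bot_iff]
    rintro ⟨g, hg⟩ h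
    rw [MulAction.mem_stabilizer_iff] at h
    rw [mem_zpowers_iff_mem_range_orderOf, Finset.mem_image] at hg
    obtain ⟨d, hd, rfl⟩ := hg
    rw [Finset.mem_range, ho] at hd
    rcases Nat.eq_zero_or_pos d with rfl | h0
    · simp
    · exact absurd h (hnf d h0 hd a)
  have e := Nat.card_congr (MulAction.selfEquivOrbitsQuotientProd hst)
  rw [Nat.card_prod, Nat.card_zpowers, ho] at e
  have e2 : Nat.card {j : ℕ // j < M + 2} = M + 2 := by
    rw [← Nat.card_congr (Fin.equivSubtype (n := M + 2)), Nat.card_fin]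
  rw [e2] at e
  exact ⟨_, by rw [e, mul_comm]⟩

end Lk

namespace Lk

theorem root {M : ℕ} (α : BraidGroup (M + 2)) (m p : ℤ) (hm : 0 < m)
    (h : α ^ m = zBraid (M + 2) ^ p) :
    ∃ (β : BraidGroup (M + 2)) (q : ℕ) (b : ℤ), 0 < q ∧ β ^ q = zBraid (M + 2) ∧ α = β ^ b := by
  set z := zBraid (M + 2) with hz
  have hc : Commute α z := ((zBraid_comm (M + 2)) α).symm
  obtain ⟨a, ha⟩ := Int.gcd_dvd_left m p
  obtain ⟨b, hb⟩ := Int.gcd_dvd_right m p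
  set g := Int.gcd m p with hg
  have hg0 : 0 < g := Int.gcd_pos_of_ne_zero_left _ hm.ne'
  have hg0' : (0 : ℤ) < g := by exact_mod_cast hg0
  have ha0 : 0 < a := by
    by_contra hcon
    push Not at hcon
    nlinarith
  have h1 : α ^ a * (z ^ b)⁻¹ = 1 := by
    apply NC.torsion_free _ g hg0
    have c1 : Commute (α ^ a) (z ^ b)⁻¹ := ((hc.zpow_left a).zpow_right b).inv_right
    rw [c1.mul_pow, ← zpow_natCast, ← zpow_natCast, ← zpow_mul, inv_zpow, ← zpow_mul,
      mul_comm a, ← ha, mul_comm b, ← hb, h, mul_inv_cancel]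
  have h2 : α ^ a = z ^ b := by rwa [mul_inv_eq_one] at h1
  have bez := Int.gcd_eq_gcd_ab m p
  set u := Int.gcdA m p
  set v := Int.gcdB m p
  have bez2 : a * u + b * v = 1 := by
    have e : (g : ℤ) * (a * u + b * v) = g * 1 := by
      calc (g : ℤ) * (a * u + b * v) = (g * a) * u + (g * b) * v := by ring
        _ = m * u + p * v := by rw [← ha, ← hb]
        _ = g * 1 := by rw [mul_one, ← bez]
    exact mul_left_cancel₀ hg0'.ne' e
  have c2 : Commute (α ^ v) (z ^ u) := (hc.zpow_left v).zpow_right u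
  refine ⟨α ^ v * z ^ u, a.toNat, b, by omega, ?_, ?_⟩
  · rw [← zpow_natCast, Int.toNat_of_nonneg ha0.le, c2.mul_zpow, ← zpow_mul, ← zpow_mul,
      mul_comm v, zpow_mul, h2, ← zpow_mul, ← zpow_add]
    have : b * v + u * a = 1 := by rw [← bez2]; ring
    rw [this, zpow_one]
  · rw [c2.mul_zpow, ← zpow_mul, ← zpow_mul, mul_comm u, zpow_mul z, ← h2, ← zpow_mul, ← zpow_add]
    have : v * b + a * u = 1 := by rw [← bez2]; ring
    rw [this, zpow_one]

theorem conj_zpow' {G : Type*} [Group G] {β g x : G} {c : ℕ} (h : β * g = g * x ^ c) (b : ℤ) :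
    IsConj (β ^ b) (x ^ ((c : ℤ) * b)) := by
  rw [isConj_comm, isConj_iff]
  refine ⟨g, ?_⟩
  have e : β = g * x ^ (c : ℤ) * g⁻¹ := by rw [zpow_natCast, ← h]; group
  rw [e, conj_zpow, ← zpow_mul]

theorem main2 {M : ℕ} (α : BraidGroup (M + 2)) (m p : ℤ) (hm : 0 < m)
    (h : α ^ m = zBraid (M + 2) ^ p) :
    ∃ k : ℤ, IsConj α (deltaBraid (M + 2) ^ k) ∨ IsConj α (epsBraid (M + 2) ^ k) := by
  obtain ⟨β, q, b, hq, hb, rfl⟩ := root α m p hm h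
  by_cases hfix : ∀ a < M + 2, pi (M + 2) β a ≠ a
  · obtain ⟨c, hc⟩ := dvd_n hq hb hfix
    obtain ⟨g, hg⟩ := NC.delta_case (m := M + 1) β q c hq (by rw [mul_comm, ← hc]) hb
    exact ⟨c * b, Or.inl (conj_zpow' hg b)⟩
  · push Not at hfix
    obtain ⟨j, hj, hf⟩ := hfix
    obtain ⟨c, g, hg⟩ := Ann.eps_case hq hb (j := j) (by omega) (by rw [tw_fst]; exact hf)
    exact ⟨c * b, Or.inr (conj_zpow' hg b)⟩

end Lk

/-- Every periodic braid (a braid with `αᵐ = Δᵖ`, `m ≠ 0`) is conjugate to a power of `δ`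
or to a power of `ε`. -/
theorem periodic_braid_conj_delta_or_eps (n : ℕ) (α : BraidGroup n) (m p : ℤ)
    (hm : m ≠ 0) (h : α ^ m = halfTwist n ^ p) :
    ∃ k : ℤ, IsConj α (deltaBraid n ^ k) ∨ IsConj α (epsBraid n ^ k) := by
  rcases Nat.lt_or_ge n 2 with hn | hn
  · have h1 : α = 1 := by
      have : (MonoidHom.id (BraidGroup n)) = 1 := braid_hom_ext fun i hi => by omega
      exact DFunLike.congr_fun this α
    exact ⟨0, Or.inl (by rw [h1, zpow_zero])⟩
  · obtain ⟨M, rfl⟩ : ∃ M, n = M + 2 := ⟨n - 2, by omega⟩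
    have h2 : α ^ (2 * m) = zBraid (M + 2) ^ p := by
      rw [mul_comm, zpow_mul, h, ← zpow_mul, mul_comm, zpow_mul, ← halfTwist_sq]
      norm_cast
    rcases lt_or_gt_of_ne hm with h0 | h0
    · refine Lk.main2 α (-(2 * m)) (-p) (by omega) ?_
      rw [zpow_neg, zpow_neg, h2]
    · exact Lk.main2 α (2 * m) p (by omega) h2
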